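/- Assume the Riemann hypothesis. There is an absolute constant C such that for all Δ ≥ 1 and all t ≥ 10, S(t) ≤ (log t)/(4πΔ) + C·e^{πΔ}. -/

import Mathlib

open Complex Real Filter MeasureTheory

namespace SBound

/-- entire normalized sinc -/
noncomputable def sc (z : ℂ) : ℂ := dslope (fun w : ℂ => Complex.sin (π * w) / π) 0 z

lemma sc_zero : sc 0 = 1 := by
  have : HasDerivAt (fun w : ℂ => Complex.sin (π * w) / π) 1 0 := by
    have h := ((Complex.hasDerivAt_sin (π * 0)).comp (0:ℂ)
      ((hasDerivAt_id (0:ℂ)).const_mul (π:ℂ))).div_const (π : ℂ)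
    simp only [mul_zero, Complex.cos_zero, one_mul, mul_one] at h
    rw [div_self (by exact_mod_cast Real.pi_ne_zero)] at h
    exact h
  simp [sc, this.deriv]

lemma mul_sc (z : ℂ) : z * sc z = Complex.sin (π * z) / π := by
  by_cases h : z = 0
  · simp [h]
  · rw [sc, dslope_of_ne _ h, slope_def_field]
    field_simp
    simp [mul_comm]

lemma sc_of_ne {z : ℂ} (h : z ≠ 0) : sc z = Complex.sin (π * z) / π / z := by
  rw [← mul_sc]; field_simp

lemma differentiable_sc : Differentiable ℂ sc := by
  have := (Complex.differentiableOn_dslope (s := Set.univ) (c := (0:ℂ))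
    (f := fun w : ℂ => Complex.sin (π * w) / π) Filter.univ_mem).2 (by fun_prop)
  exact differentiableOn_univ.1 this

lemma sc_neg (z : ℂ) : sc (-z) = sc z := by
  by_cases h : z = 0
  · simp [h]
  · rw [sc_of_ne h, sc_of_ne (neg_ne_zero.2 h)]
    rw [mul_neg, Complex.sin_neg]; field_simp

lemma sc_ofReal (x : ℝ) : sc x = (Real.sinc (π * x) : ℝ) := by
  by_cases h : x = 0
  · simp [h, sc_zero]
  · rw [sc_of_ne (by exact_mod_cast h), Real.sinc_of_ne_zero (by positivity)]
    push_cast; field_simp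

lemma norm_cos_le (z : ℂ) : ‖Complex.cos z‖ ≤ Real.exp |z.im| := by
  rw [Complex.cos, norm_div]
  have h1 : ‖cexp (z * I)‖ ≤ Real.exp |z.im| := by
    rw [Complex.norm_exp]; gcongr; simp; exact neg_le_abs _
  have h2 : ‖cexp (-z * I)‖ ≤ Real.exp |z.im| := by
    rw [Complex.norm_exp]; gcongr; simp; exact le_abs_self _
  have := norm_add_le (cexp (z * I)) (cexp (-z * I))
  simp only [Complex.norm_ofNat]
  linarith

lemma norm_sin_le (z : ℂ) : ‖Complex.sin z‖ ≤ Real.exp |z.im| := by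
  have := norm_cos_le (z - π / 2)
  rw [Complex.cos_sub_pi_div_two] at this
  have e : (z - π / 2).im = z.im := by
    have : ((π:ℂ) / 2) = ((π / 2 : ℝ) : ℂ) := by push_cast; rfl
    rw [this, Complex.sub_im, Complex.ofReal_im, sub_zero]
  rwa [e] at this

lemma norm_sin_le' (z : ℂ) : ‖Complex.sin z‖ ≤ Real.exp |z.im| * ‖z‖ := by
  have hconv : Convex ℝ {w : ℂ | |w.im| ≤ |z.im|} := by
    have : {w : ℂ | |w.im| ≤ |z.im|} = Complex.imLm ⁻¹' (Set.Icc (-|z.im|) |z.im|) := by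
      ext w; simp [abs_le]
    rw [this]; exact (convex_Icc _ _).linear_preimage _
  have := hconv.norm_image_sub_le_of_norm_hasDerivWithin_le (f := Complex.sin) (f' := Complex.cos)
    (C := Real.exp |z.im|) (x := 0) (y := z)
    (fun x _ => (Complex.hasDerivAt_sin x).hasDerivWithinAt)
    (fun x hx => (norm_cos_le x).trans (Real.exp_le_exp.2 (by simpa using hx)))
    (by rw [Set.mem_ofPred_eq]; simp) (by rw [Set.mem_ofPred_eq])
  simpa using this

lemma norm_sc_le (z : ℂ) : ‖sc z‖ ≤ Real.exp (π * |z.im|) := by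
  by_cases h : z = 0
  · simp [h, sc_zero]
  · rw [sc_of_ne h, norm_div, norm_div, div_div, div_le_iff₀
      (mul_pos (by simpa using Real.pi_ne_zero) (norm_pos_iff.2 h))]
    have := norm_sin_le' (π * z)
    simp [abs_mul, abs_of_pos Real.pi_pos] at this
    simpa [abs_of_pos Real.pi_pos] using this

lemma norm_sc_mul_le (z : ℂ) : ‖z‖ * ‖sc z‖ ≤ Real.exp (π * |z.im|) / π := by
  rw [← norm_mul, mul_sc, norm_div]
  have := norm_sin_le (π * z)
  simp [abs_mul, abs_of_pos Real.pi_pos] at this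
  simp only [Complex.norm_real, Real.norm_eq_abs, abs_of_pos Real.pi_pos]
  gcongr

noncomputable def q (z : ℂ) : ℂ := sc z ^ 2

lemma differentiable_q : Differentiable ℂ q := differentiable_sc.pow 2

lemma q_neg (z : ℂ) : q (-z) = q z := by simp [q, sc_neg]

lemma q_bound (z : ℂ) : ‖q z‖ * (1 + ‖z‖ ^ 2) ≤ 2 * Real.exp (2 * π * |z.im|) := by
  have h1 := norm_sc_le z
  have h2 := norm_sc_mul_le z
  have h3 : Real.exp (π * |z.im|) / π ≤ Real.exp (π * |z.im|) :=
    div_le_self (by positivity) (by linarith [Real.pi_gt_three])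
  have e : Real.exp (2 * π * |z.im|) = Real.exp (π * |z.im|) ^ 2 := by
    rw [← Real.exp_nat_mul]; congr 1; push_cast; ring
  rw [e, q, norm_pow]
  have h4 : ‖sc z‖ ^ 2 ≤ Real.exp (π * |z.im|) ^ 2 := by gcongr
  have h5 : (‖z‖ * ‖sc z‖) ^ 2 ≤ Real.exp (π * |z.im|) ^ 2 := by gcongr; linarith
  nlinarith

noncomputable def W (z : ℂ) : ℂ := ∑' n : ℕ, q (z + n + 1)

lemma q_shift_bound (R : ℝ) (z : ℂ) (hz : ‖z‖ ≤ R) (n : ℕ) :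
    ‖q (z + n + 1)‖ ≤ (4 * (1 + R ^ 2) * Real.exp (2 * π * R)) * (1 / ((n : ℝ) + 1) ^ 2) := by
  have hR : 0 ≤ R := (norm_nonneg z).trans hz
  have h1 := q_bound (z + n + 1)
  have him : (z + n + 1).im = z.im := by simp
  rw [him] at h1
  have h2 : Real.exp (2 * π * |z.im|) ≤ Real.exp (2 * π * R) := by
    gcongr; exact (Complex.abs_im_le_norm z).trans hz
  have h3 : ((n : ℝ) + 1) ≤ ‖z + n + 1‖ + ‖z‖ := by
    have : ((n : ℂ) + 1) = (z + n + 1) - z := by ring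
    have h := norm_sub_le (z + n + 1) z
    rw [← this] at h
    have e : ‖(n : ℂ) + 1‖ = (n : ℝ) + 1 := by
      have : ((n : ℂ) + 1) = ((n + 1 : ℕ) : ℂ) := by push_cast; rfl
      rw [this, Complex.norm_natCast]; push_cast; rfl
    rwa [e] at h
  have h4 : ((n : ℝ) + 1) ^ 2 ≤ 2 * (1 + R ^ 2) * (1 + ‖z + n + 1‖ ^ 2) := by
    have : ‖z‖ ^ 2 ≤ R ^ 2 := by gcongr
    have h5 : ((n : ℝ) + 1) ^ 2 ≤ (‖z + n + 1‖ + ‖z‖) ^ 2 := by gcongr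
    nlinarith [sq_nonneg (‖z + n + 1‖ - ‖z‖), mul_nonneg (sq_nonneg R) (sq_nonneg ‖z + n + 1‖)]
  rw [mul_one_div, le_div_iff₀ (by positivity)]
  calc ‖q (z + n + 1)‖ * ((n : ℝ) + 1) ^ 2 ≤ ‖q (z + n + 1)‖ * (2 * (1 + R ^ 2) * (1 + ‖z + n + 1‖ ^ 2)) := by gcongr
    _ = 2 * (1 + R ^ 2) * (‖q (z + n + 1)‖ * (1 + ‖z + n + 1‖ ^ 2)) := by ring
    _ ≤ 2 * (1 + R ^ 2) * (2 * Real.exp (2 * π * R)) :=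
        mul_le_mul_of_nonneg_left (by linarith) (by positivity)
    _ = _ := by ring

lemma summable_inv_sq : Summable (fun n : ℕ => 1 / ((n : ℝ) + 1) ^ 2) := by
  have := (summable_nat_add_iff 1).2 (Real.summable_one_div_nat_pow.2 (one_lt_two))
  simpa using this

lemma summable_q (z : ℂ) : Summable (fun n : ℕ => q (z + n + 1)) :=
  Summable.of_norm_bounded (summable_inv_sq.mul_left _) (q_shift_bound ‖z‖ z le_rfl)

lemma differentiable_W : Differentiable ℂ W := by
  intro z
  have : DifferentiableOn ℂ W (Metric.ball 0 (‖z‖ + 1)) := by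
    apply Complex.differentiableOn_tsum_of_summable_norm
      (summable_inv_sq.mul_left (4 * (1 + (‖z‖ + 1) ^ 2) * Real.exp (2 * π * (‖z‖ + 1))))
    · intro n
      exact (differentiable_q.comp (by fun_prop : Differentiable ℂ fun w : ℂ => w + n + 1)).differentiableOn
    · exact Metric.isOpen_ball
    · intro n w hw
      exact q_shift_bound _ w (by simpa using (Metric.mem_ball.1 hw).le) n
  exact (this z (by simp)).differentiableAt (Metric.isOpen_ball.mem_nhds (by simp))

end SBound


namespace SBound

lemma sin_sq_add_int (z : ℂ) (n : ℤ) : Complex.sin (π * (z + n)) ^ 2 = Complex.sin (π * z) ^ 2 := by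
  have h : (π : ℂ) * (z + n) = π * z + n * π := by ring
  rw [h]
  have h2 : ∀ w : ℂ, Complex.sin w ^ 2 = (1 - Complex.cos (2 * w)) / 2 := by
    intro w; rw [Complex.cos_two_mul]
    have := Complex.sin_sq_add_cos_sq w
    linear_combination this
  rw [h2, h2]
  congr 2
  have : 2 * ((π : ℂ) * z + n * π) = 2 * (π * z) + n * (2 * π) := by ring
  rw [this, Complex.cos_add_int_mul_two_pi]

lemma q_of_ne {z : ℂ} (h : z ≠ 0) : q z = (Complex.sin (π * z) / π) ^ 2 * (1 / z ^ 2) := by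
  rw [q, sc_of_ne h]; field_simp

lemma q_add_int {z : ℂ} (n : ℤ) (h : z + n ≠ 0) :
    q (z + n) = (Complex.sin (π * z) / π) ^ 2 * (1 / (z + n) ^ 2) := by
  rw [q_of_ne h, div_pow, sin_sq_add_int, div_pow]

lemma q_add_nat {z : ℂ} (n : ℕ) (h : z + n ≠ 0) :
    q (z + n) = (Complex.sin (π * z) / π) ^ 2 * (1 / (z + n) ^ 2) := by
  have := q_add_int (z := z) (n : ℤ) (by simpa using h)
  simpa using this

lemma hasSum_q_int (z : ℂ) : HasSum (fun n : ℤ => q (z + n)) (q z + W z + W (-z)) := by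
  have h1 : HasSum (fun n : ℕ => q (z + ((n : ℤ) : ℂ))) (q z + W z) := by
    rw [← hasSum_nat_add_iff' 1]
    have h : HasSum (fun n : ℕ => q (z + n + 1)) (W z) := (summable_q z).hasSum
    have e : q z + W z - ∑ i ∈ Finset.range 1, q (z + ((i : ℤ) : ℂ)) = W z := by simp
    rw [e]
    refine h.congr_fun (fun n => ?_)
    congr 1; push_cast; ring
  have h2 : HasSum (fun n : ℕ => q (z + ((-((n : ℤ) + 1) : ℤ) : ℂ))) (W (-z)) := by
    have h : HasSum (fun n : ℕ => q (-z + n + 1)) (W (-z)) := (summable_q (-z)).hasSum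
    refine h.congr_fun (fun n => ?_)
    rw [← q_neg]; congr 1; push_cast; ring
  exact h1.of_nat_of_neg_add_one h2

lemma partition_upper (z : ℂ) (hz : 0 < z.im) : q z + W z + W (-z) = 1 := by
  have hne : ∀ n : ℤ, z + n ≠ 0 := by
    intro n h
    have := congrArg Complex.im h
    simp at this
    linarith
  have hE := EisensteinSeries.qExpansion_identity (k := 1) le_rfl ⟨z, hz⟩
  set w : ℂ := cexp (2 * π * I * z) with hw
  have hw1 : ‖w‖ < 1 := by
    rw [hw, Complex.norm_exp]
    simp
    positivity
  have hw0 : w ≠ 0 := Complex.exp_ne_zero _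
  have hw11 : 1 - w ≠ 0 := by
    intro h
    have : w = 1 := by linear_combination -h
    rw [this] at hw1; simp at hw1
  have hgeo := tsum_coe_mul_geometric_of_norm_lt_one hw1
  simp only [pow_one] at hE
  rw [hgeo] at hE
  have hsin : (Complex.sin (π * z)) ^ 2 = -(1 - w) ^ 2 / (4 * w) := by
    set u : ℂ := cexp (π * z * I) with hu
    have hu0 : u ≠ 0 := Complex.exp_ne_zero _
    have e1 : w = u ^ 2 := by rw [hw, hu, ← Complex.exp_nat_mul]; congr 1; push_cast; ring
    have e2 : cexp (-(π * z) * I) = u⁻¹ := by rw [hu, ← Complex.exp_neg]; congr 1; ring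
    rw [Complex.sin, e2, ← hu, e1]
    field_simp
    rw [Complex.I_sq]; ring
  have hsum := hasSum_q_int z
  rw [← hsum.tsum_eq]
  simp_rw [fun n : ℤ => q_add_int n (hne n)]
  rw [tsum_mul_left, hE, div_pow, hsin]
  have hpi : (π : ℂ) ≠ 0 := by exact_mod_cast Real.pi_ne_zero
  simp only [Nat.factorial_one, Nat.cast_one, div_one]
  field_simp
  ring_nf
  simp

lemma partition (z : ℂ) : q z + W z + W (-z) = 1 := by
  have hd : Differentiable ℂ (fun z => q z + W z + W (-z)) :=
    (differentiable_q.add differentiable_W).add (differentiable_W.comp differentiable_neg)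
  have ha : AnalyticOnNhd ℂ (fun z => q z + W z + W (-z)) Set.univ :=
    (hd.differentiableOn).analyticOnNhd isOpen_univ
  have hb : AnalyticOnNhd ℂ (fun _ : ℂ => (1 : ℂ)) Set.univ := analyticOnNhd_const
  have := ha.eq_of_eventuallyEq hb (z₀ := I) (by
    have : {z : ℂ | 0 < z.im} ∈ nhds I :=
      (isOpen_lt continuous_const Complex.continuous_im).mem_nhds (by simp)
    filter_upwards [this] with z hz using partition_upper z (by simpa using hz))
  exact congrFun this z

noncomputable def V (z : ℂ) : ℂ := z * q z - W z

lemma differentiable_V : Differentiable ℂ V :=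
  (differentiable_id.mul differentiable_q).sub differentiable_W

lemma V_neg (z : ℂ) : V (-z) = q z - 1 - V z := by
  have := partition z
  simp only [V, q_neg]
  linear_combination -this

/-- telescoping sum of reciprocals -/
lemma hasSum_telescope (z : ℂ) :
    HasSum (fun n : ℕ => 1 / (z + n) - 1 / (z + n + 1)) (1 / z) ∨ ¬ 0 < z.re := by
  by_cases h : 0 < z.re
  · left
    have hn : ∀ n : ℕ, 0 < (z + n).re := fun n => by simp; positivity
    have hlow : ∀ n : ℕ, (z.re + n) ≤ ‖z + n‖ := fun n => by
      have := Complex.re_le_norm (z + n); simpa using this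
    have hsm : Summable (fun n : ℕ => 1 / (z + n) - 1 / (z + n + 1)) := by
      have hb : Summable (fun n : ℕ => (1 / min z.re 1 ^ 2) * (1 / ((n : ℝ) + 1) ^ 2)) := summable_inv_sq.mul_left _
      refine Summable.of_norm_bounded hb (fun n => ?_)
      have h1 : z + n ≠ 0 := fun h' => by have := hn n; rw [h'] at this; simp at this
      have h2 : z + n + 1 ≠ 0 := fun h' => by
        have := hn (n+1); push_cast at this; rw [← add_assoc, h'] at this; simp at this
      have e : 1 / (z + n) - 1 / (z + n + 1) = 1 / ((z + n) * (z + n + 1)) := by field_simp; ring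
      rw [e, norm_div, norm_one, norm_mul, one_div_mul_one_div]
      have hm : 0 < min z.re 1 := lt_min h one_pos
      have ha : min z.re 1 * ((n : ℝ) + 1) ≤ ‖z + n‖ := by
        refine le_trans ?_ (hlow n)
        nlinarith [min_le_left z.re 1, min_le_right z.re 1, (Nat.cast_nonneg n : (0:ℝ) ≤ n)]
      have hb : min z.re 1 * ((n : ℝ) + 1) ≤ ‖z + n + 1‖ := by
        have := hlow (n+1); push_cast at this; rw [← add_assoc z] at this
        refine le_trans ?_ this
        nlinarith [min_le_left z.re 1, min_le_right z.re 1, (Nat.cast_nonneg n : (0:ℝ) ≤ n)]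
      apply one_div_le_one_div_of_le (by positivity)
      calc min z.re 1 ^ 2 * ((n : ℝ) + 1) ^ 2 = (min z.re 1 * ((n : ℝ) + 1)) * (min z.re 1 * ((n : ℝ) + 1)) := by ring
        _ ≤ _ := by gcongr
    rw [hsm.hasSum_iff_tendsto_nat]
    have hs : ∀ n : ℕ, ∑ i ∈ Finset.range n, (1 / (z + i) - 1 / (z + i + 1)) = 1 / z - 1 / (z + n) := by
      intro n
      induction n with
      | zero => simp
      | succ k ih => rw [Finset.sum_range_succ, ih]; push_cast; rw [add_assoc z]; ring
    simp_rw [hs]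
    have : Tendsto (fun n : ℕ => 1 / (z + n)) atTop (nhds 0) := by
      rw [tendsto_zero_iff_norm_tendsto_zero]
      refine squeeze_zero' (Eventually.of_forall fun n => norm_nonneg _) ?_
        (tendsto_one_div_atTop_nhds_zero_nat)
      filter_upwards [eventually_gt_atTop 0] with n hn
      rw [norm_div, norm_one]
      have : (0:ℝ) < n := by exact_mod_cast hn
      apply one_div_le_one_div_of_le this
      linarith [hlow n]
    simpa using tendsto_const_nhds.sub this
  · right; exact h

lemma V_hasSum {z : ℂ} (h : 0 < z.re) :
    HasSum (fun n : ℕ => (Complex.sin (π * z) / π) ^ 2 * (1 / ((z + n) * (z + n + 1) ^ 2))) (V z) := by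
  have hn : ∀ n : ℕ, z + n ≠ 0 := fun n h' => by
    have : (z + n).re = z.re + n := by simp
    rw [h'] at this; simp at this; have := (Nat.cast_nonneg n : (0:ℝ) ≤ n); linarith
  have hn1 : ∀ n : ℕ, z + n + 1 ≠ 0 := fun n h' => hn (n+1) (by push_cast; rw [← add_assoc, h'])
  have h1 := ((hasSum_telescope z).resolve_right (by simpa using h)).mul_left ((Complex.sin (π * z) / π) ^ 2)
  have h2 := h1.sub (summable_q z).hasSum
  have hz : z ≠ 0 := by simpa using hn 0
  have hV : V z = (Complex.sin (↑π * z) / ↑π) ^ 2 * (1 / z) - ∑' (b : ℕ), q (z + ↑b + 1) := by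
    rw [V, q_of_ne hz, W]
    field_simp
  rw [hV]
  refine h2.congr_fun ?_
  · intro n
    have : z + n + 1 = z + ((n + 1 : ℕ) : ℂ) := by push_cast; ring
    rw [this, q_add_nat (n+1) (by rw [← this]; exact hn1 n), ← this]
    have := hn n
    have := hn1 n
    field_simp
    ring

lemma hasSum_sq_telescope {x : ℝ} (h : 0 < x) :
    HasSum (fun n : ℕ => 1 / (x + n) ^ 2 - 1 / (x + n + 1) ^ 2) (1 / x ^ 2) := by
  have hs : ∀ n : ℕ, ∑ i ∈ Finset.range n, (1 / (x + i) ^ 2 - 1 / (x + i + 1) ^ 2) = 1 / x ^ 2 - 1 / (x + n) ^ 2 := by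
    intro n
    induction n with
    | zero => simp
    | succ k ih => rw [Finset.sum_range_succ, ih]; push_cast; rw [add_assoc x]; ring
  rw [hasSum_iff_tendsto_nat_of_nonneg]
  · simp_rw [hs]
    have : Tendsto (fun n : ℕ => 1 / (x + n) ^ 2) atTop (nhds 0) := by
      have h1 : Tendsto (fun n : ℕ => (x + n)) atTop atTop :=
        tendsto_atTop_add_const_left _ _ tendsto_natCast_atTop_atTop
      have := (tendsto_pow_atTop (two_ne_zero)).comp h1
      refine this.inv_tendsto_atTop.congr (fun n => ?_)
      simp
    simpa using tendsto_const_nhds.sub this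
  · intro n
    rw [sub_nonneg]
    apply one_div_le_one_div_of_le (by positivity)
    gcongr ?_ ^ 2; linarith

lemma key_ineq (a : ℝ) (ha : 0 < a) : 1 / (a * (a + 1) ^ 2) ≤ (1 / 2) * (1 / a ^ 2 - 1 / (a + 1) ^ 2) := by
  rw [div_sub_div _ _ (by positivity) (by positivity), div_mul_div_comm, div_le_div_iff₀ (by positivity) (by positivity)]
  have : 0 < a ^ 2 * (a+1)^2 := by positivity
  nlinarith [mul_pos ha this]

lemma V_bound {z : ℂ} (h : 0 < z.re) :
    ‖V z‖ ≤ Real.exp (2 * π * |z.im|) / z.re ^ 2 := by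
  have h1 := (hasSum_sq_telescope h).mul_left ((1 : ℝ) / 2)
  have h2 := h1.mul_left (‖(Complex.sin (π * z) / π) ^ 2‖)
  have h3 : ‖V z‖ ≤ ‖(Complex.sin (π * z) / π) ^ 2‖ * (1 / 2 * (1 / z.re ^ 2)) := by
    rw [← (V_hasSum h).tsum_eq]
    apply tsum_of_norm_bounded h2
    intro n
    rw [norm_mul]
    gcongr
    rw [norm_div, norm_one, norm_mul, norm_pow]
    have hn : 0 < z.re + n := by positivity
    have a1 : z.re + n ≤ ‖z + n‖ := by have := Complex.re_le_norm (z + n); simpa using this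
    have a2 : z.re + n + 1 ≤ ‖z + n + 1‖ := by have := Complex.re_le_norm (z + n + 1); simpa using this
    refine le_trans ?_ (key_ineq _ hn)
    apply one_div_le_one_div_of_le (by positivity)
    gcongr
  refine h3.trans ?_
  have h4 : ‖(Complex.sin (π * z) / π) ^ 2‖ ≤ Real.exp (2 * π * |z.im|) := by
    have e : Real.exp (2 * π * |z.im|) = Real.exp (π * |z.im|) ^ 2 := by
      rw [← Real.exp_nat_mul]; congr 1; push_cast; ring
    rw [norm_pow, e]
    gcongr
    have := norm_sin_le (π * z)
    simp [abs_mul, abs_of_pos Real.pi_pos] at this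
    rw [norm_div]
    simp only [Complex.norm_real, Real.norm_eq_abs, abs_of_pos Real.pi_pos]
    refine (div_le_self (norm_nonneg _) (by linarith [Real.pi_gt_three])).trans this
  calc _ ≤ Real.exp (2 * π * |z.im|) * (1 * (1 / z.re ^ 2)) := by gcongr; norm_num
    _ = _ := by ring

/-- real version of q and V -/
noncomputable def qr (x : ℝ) : ℝ := Real.sinc (π * x) ^ 2

noncomputable def vr (x : ℝ) : ℝ := x * qr x - ∑' n : ℕ, qr (x + n + 1)

lemma q_ofReal (x : ℝ) : q x = (qr x : ℝ) := by rw [q, sc_ofReal, qr]; push_cast; rfl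

lemma V_ofReal (x : ℝ) : V x = (vr x : ℝ) := by
  rw [V, vr, W]
  push_cast
  rw [q_ofReal]
  congr 2
  ext n
  rw [← q_ofReal]; push_cast; rfl

lemma vr_neg (x : ℝ) : vr (-x) = qr x - 1 - vr x := by
  have := V_neg (x : ℂ)
  rw [← Complex.ofReal_neg, V_ofReal, V_ofReal, q_ofReal] at this
  exact_mod_cast this

lemma vr_hasSum {x : ℝ} (h : 0 < x) :
    HasSum (fun n : ℕ => (Real.sin (π * x) / π) ^ 2 * (1 / ((x + n) * (x + n + 1) ^ 2))) (vr x) := by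
  have := V_hasSum (z := (x : ℂ)) (by simpa using h)
  rw [V_ofReal] at this
  rw [← Complex.hasSum_ofReal]
  convert this using 1
  ext n
  push_cast; rfl

lemma vr_nonneg {x : ℝ} (h : 0 < x) : 0 ≤ vr x :=
  (vr_hasSum h).nonneg (fun n => by positivity)

lemma vr_le {x : ℝ} (h : 0 < x) : vr x ≤ qr x / 2 := by
  have h1 := ((hasSum_sq_telescope h).mul_left ((1 : ℝ) / 2)).mul_left ((Real.sin (π * x) / π) ^ 2)
  have h2 := hasSum_le (fun n => ?_) (vr_hasSum h) h1
  · refine h2.trans (le_of_eq ?_)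
    rw [qr, Real.sinc_of_ne_zero (by positivity)]
    field_simp
  · have : 0 < x + n := by positivity
    have := key_ineq _ this
    gcongr

end SBound


namespace SBound

lemma exists_V_bound : ∃ K : ℝ, 0 < K ∧
    (∀ z : ℂ, ‖V z‖ ≤ K * Real.exp (2 * π * |z.im|)) ∧
    (∀ z : ℂ, 0 < z.re → ‖V z‖ ≤ K * Real.exp (2 * π * |z.im|) / z.re ^ 2) ∧
    (∀ z : ℂ, z.re < 0 → ‖V z + 1‖ ≤ K * Real.exp (2 * π * |z.im|) / z.re ^ 2) := by
  have hS : 0 ≤ ∑' n : ℕ, 1 / ((n : ℝ) + 1) ^ 2 := tsum_nonneg fun n => by positivity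
  have hqz : ∀ z : ℂ, ‖q z‖ * ‖z‖ ^ 2 ≤ 2 * Real.exp (2 * π * |z.im|) := fun z => by
    have := q_bound z
    nlinarith [norm_nonneg (q z)]
  have hre : ∀ z : ℂ, z.re ^ 2 ≤ ‖z‖ ^ 2 := fun z => by
    rw [← sq_abs z.re]; gcongr; exact Complex.abs_re_le_norm z
  have hqr : ∀ z : ℂ, z.re ≠ 0 → ‖q z‖ ≤ 2 * Real.exp (2 * π * |z.im|) / z.re ^ 2 := fun z hz => by
    rw [le_div_iff₀ (by positivity)]
    exact (mul_le_mul_of_nonneg_left (hre z) (norm_nonneg _)).trans (hqz z)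
  have hexp : ∀ z : ℂ, 1 ≤ Real.exp (2 * π * |z.im|) := fun z => Real.one_le_exp (by positivity)
  -- bound in the strip
  have hstrip : ∀ z : ℂ, |z.re| ≤ 1 / 2 → ‖V z‖ ≤ (2 + 8 * ∑' n : ℕ, 1 / ((n : ℝ) + 1) ^ 2) * Real.exp (2 * π * |z.im|) := by
    intro z hz
    have h1 : ‖z * q z‖ ≤ 2 * Real.exp (2 * π * |z.im|) := by
      rw [norm_mul]
      have := q_bound z
      nlinarith [norm_nonneg (q z), sq_nonneg (‖z‖ - 1), mul_nonneg (norm_nonneg (q z)) (sq_nonneg (‖z‖ - 1))]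
    have h2 : ‖W z‖ ≤ (8 * Real.exp (2 * π * |z.im|)) * ∑' n : ℕ, 1 / ((n : ℝ) + 1) ^ 2 := by
      apply tsum_of_norm_bounded (summable_inv_sq.hasSum.mul_left _)
      intro n
      have hr : (z + n + 1).re = z.re + n + 1 := by simp
      have hi : (z + n + 1).im = z.im := by simp
      have hlow : ((n : ℝ) + 1) / 2 ≤ z.re + n + 1 := by
        have := (abs_le.1 hz).1; have := (Nat.cast_nonneg n : (0:ℝ) ≤ n); linarith
      have := hqr (z + n + 1) (by rw [hr]; have : (0:ℝ) < ((n : ℝ) + 1) / 2 := by positivity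
                                  linarith)
      rw [hr, hi] at this
      refine this.trans ?_
      rw [mul_one_div]
      calc 2 * Real.exp (2 * π * |z.im|) / (z.re + n + 1) ^ 2 ≤ 2 * Real.exp (2 * π * |z.im|) / (((n : ℝ) + 1) / 2) ^ 2 := by gcongr
        _ = _ := by field_simp; ring
    rw [V]
    have := norm_sub_le (z * q z) (W z)
    nlinarith
  have hpos : ∀ z : ℂ, 0 < z.re → ‖V z‖ ≤ 1 * Real.exp (2 * π * |z.im|) / z.re ^ 2 := fun z hz => by
    rw [one_mul]; exact V_bound hz
  have hneg : ∀ z : ℂ, z.re < 0 → ‖V z + 1‖ ≤ 3 * Real.exp (2 * π * |z.im|) / z.re ^ 2 := fun z hz => by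
    have e : V z + 1 = q z - V (-z) := by rw [V_neg]; ring
    have h1 := hpos (-z) (by simpa using hz)
    have h2 := hqr z hz.ne
    rw [e]
    have h3 := norm_sub_le (q z) (V (-z))
    simp only [Complex.neg_im, abs_neg, Complex.neg_re, neg_sq] at h1
    have : 3 * Real.exp (2 * π * |z.im|) / z.re ^ 2 = 2 * Real.exp (2 * π * |z.im|) / z.re ^ 2 + 1 * Real.exp (2 * π * |z.im|) / z.re ^ 2 := by ring
    linarith
  refine ⟨13 + 8 * ∑' n : ℕ, 1 / ((n : ℝ) + 1) ^ 2, by positivity, ?_, ?_, ?_⟩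
  · intro z
    have hE := hexp z
    rcases le_or_gt |z.re| (1/2) with h | h
    · refine (hstrip z h).trans ?_
      gcongr; norm_num
    · have h4 : (1/4 : ℝ) ≤ z.re ^ 2 := by rw [← sq_abs]; nlinarith
      have aux : ∀ c : ℝ, 0 ≤ c → c * Real.exp (2 * π * |z.im|) / z.re ^ 2 ≤ 4 * c * Real.exp (2 * π * |z.im|) := by
        intro c hc
        rw [div_le_iff₀ (by linarith)]
        nlinarith [mul_nonneg hc (by linarith : 0 ≤ Real.exp (2 * π * |z.im|))]
      rcases lt_or_gt_of_ne (by intro h0; rw [h0] at h; norm_num at h : z.re ≠ 0) with h5 | h5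
      · have h6 := (hneg z h5).trans (aux 3 (by norm_num))
        have h7 : ‖V z‖ ≤ ‖V z + 1‖ + 1 := by
          have := norm_sub_le (V z + 1) 1
          simpa using this
        nlinarith
      · have h6 := (hpos z h5).trans (aux 1 (by norm_num))
        nlinarith
  · intro z hz
    refine (hpos z hz).trans ?_
    gcongr; linarith
  · intro z hz
    refine (hneg z hz).trans ?_
    gcongr; linarith

lemma exists_derivV_bound : ∃ K : ℝ, 0 < K ∧
    ∀ z : ℂ, ‖deriv V z‖ ≤ K * Real.exp (2 * π * |z.im|) / (1 + z.re ^ 2) := by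
  obtain ⟨K, hK, h0, h1, h2⟩ := exists_V_bound
  set E := Real.exp (2 * π)
  have hE : 0 < E := Real.exp_pos _
  have him : ∀ z w : ℂ, w ∈ Metric.sphere z (1/2) → Real.exp (2 * π * |w.im|) ≤ E * Real.exp (2 * π * |z.im|) := by
    intro z w hw
    rw [← Real.exp_add]
    have : |w.im - z.im| ≤ 1 / 2 := by
      rw [← Complex.sub_im]; refine (Complex.abs_im_le_norm _).trans ?_
      rw [← dist_eq_norm]; exact le_of_eq (Metric.mem_sphere.1 hw)
    have h3 : |w.im| ≤ 1 + |z.im| := by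
      have := abs_sub_abs_le_abs_sub w.im z.im; linarith
    gcongr
    nlinarith [Real.pi_pos]
  have hrew : ∀ z w : ℂ, w ∈ Metric.sphere z (1/2) → |w.re - z.re| ≤ 1 / 2 := by
    intro z w hw
    rw [← Complex.sub_re]; refine (Complex.abs_re_le_norm _).trans ?_
    rw [← dist_eq_norm]; exact le_of_eq (Metric.mem_sphere.1 hw)
  refine ⟨16 * K * E, by positivity, fun z => ?_⟩
  have hden : 0 < 1 + z.re ^ 2 := by positivity
  have hez := Real.exp_pos (2 * π * |z.im|)
  rcases le_or_gt |z.re| 1 with h | h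
  · have := Complex.norm_deriv_le_of_forall_mem_sphere_norm_le (c := z) (R := 1/2) (C := K * (E * Real.exp (2 * π * |z.im|))) (by norm_num)
      (differentiable_V.diffContOnCl (s := Metric.ball z (1/2))) (fun w hw => (h0 w).trans (by gcongr; exact him z w hw))
    refine this.trans ?_
    rw [le_div_iff₀ hden]
    have : z.re ^ 2 ≤ 1 := by rw [← sq_abs]; nlinarith [abs_nonneg z.re]
    have hp : 0 < K * (E * Real.exp (2 * π * |z.im|)) := by positivity
    nlinarith
  · have h4 : 1 < z.re ^ 2 := by rw [← sq_abs]; nlinarith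
    have haux : ∀ w : ℂ, w ∈ Metric.sphere z (1/2) → z.re ^ 2 / 4 ≤ w.re ^ 2 := by
      intro w hw
      have h5 := hrew z w hw
      have : |z.re| / 2 ≤ |w.re| := by
        have := abs_sub_abs_le_abs_sub z.re w.re
        rw [abs_sub_comm] at this; linarith
      rw [← sq_abs z.re, ← sq_abs w.re]
      nlinarith [abs_nonneg z.re]
    have hfin : ∀ w : ℂ, w ∈ Metric.sphere z (1/2) → K * Real.exp (2 * π * |w.im|) / w.re ^ 2 ≤ K * (E * Real.exp (2 * π * |z.im|)) / (z.re ^ 2 / 4) := by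
      intro w hw
      have := haux w hw
      have := him z w hw
      gcongr
    have hlast : K * (E * Real.exp (2 * π * |z.im|)) / (z.re ^ 2 / 4) / (1/2) ≤ 16 * K * E * Real.exp (2 * π * |z.im|) / (1 + z.re ^ 2) := by
      rw [div_div, div_le_div_iff₀ (by positivity) hden]
      have hp : 0 < K * (E * Real.exp (2 * π * |z.im|)) := by positivity
      nlinarith
    rcases lt_or_ge z.re 0 with h5 | h5
    · have hd : deriv V z = deriv (fun w => V w + 1) z := by rw [deriv_add_const]
      rw [hd]
      refine (Complex.norm_deriv_le_of_forall_mem_sphere_norm_le (c := z) (R := 1/2) (f := fun w => V w + 1) (by norm_num)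
        ((differentiable_V.add_const 1).diffContOnCl (s := Metric.ball z (1/2))) (fun w hw => (h2 w ?_).trans (hfin w hw))).trans hlast
      have h6 := hrew z w hw
      rw [abs_of_neg h5] at h
      linarith [(abs_le.1 h6).2]
    · refine (Complex.norm_deriv_le_of_forall_mem_sphere_norm_le (c := z) (R := 1/2) (by norm_num)
        (differentiable_V.diffContOnCl (s := Metric.ball z (1/2))) (fun w hw => (h1 w ?_).trans (hfin w hw))).trans hlast
      have h6 := hrew z w hw
      rw [abs_of_nonneg h5] at h
      linarith [(abs_le.1 h6).1]

lemma hasDerivAt_vr (x : ℝ) : HasDerivAt vr (deriv V x).re x := by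
  have h := ((differentiable_V (x : ℂ)).hasDerivAt).real_of_complex
  refine h.congr_of_eventuallyEq (Eventually.of_forall fun y => ?_)
  simp only [V_ofReal, Complex.ofReal_re]

lemma deriv_V_ofReal (x : ℝ) : deriv V x = ((deriv V x).re : ℝ) := by
  have h := ((differentiable_V (x : ℂ)).hasDerivAt).comp_ofReal
  have h2 : HasDerivAt (fun y : ℝ => ((vr y : ℝ) : ℂ)) (((deriv V x).re : ℝ) : ℂ) x := (hasDerivAt_vr x).ofReal_comp
  have h3 : (fun y : ℝ => V y) = (fun y : ℝ => ((vr y : ℝ) : ℂ)) := by ext y; exact V_ofReal y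
  rw [h3] at h
  exact h.unique h2

lemma qr_nonneg (x : ℝ) : 0 ≤ qr x := sq_nonneg _
lemma qr_neg (x : ℝ) : qr (-x) = qr x := by simp [qr, Real.sinc_neg]
lemma continuous_qr : Continuous qr := by unfold qr; have := Real.continuous_sinc; fun_prop
lemma qr_le (x : ℝ) : qr x ≤ 2 / (1 + x ^ 2) := by
  have := q_bound (x : ℂ)
  rw [q_ofReal] at this
  simp [abs_of_nonneg (qr_nonneg x)] at this
  rw [le_div_iff₀ (by positivity)]; exact this

lemma integrable_qr : Integrable qr := by
  refine Integrable.mono' (integrable_inv_one_add_sq.const_mul 2) continuous_qr.aestronglyMeasurable ?_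
  refine Eventually.of_forall fun x => ?_
  rw [Real.norm_eq_abs, abs_of_nonneg (qr_nonneg x)]
  exact qr_le x

lemma hasSum_qr (x : ℝ) : HasSum (fun n : ℤ => qr (x + n)) 1 := by
  have := hasSum_q_int (x : ℂ)
  rw [partition] at this
  rw [← Complex.hasSum_ofReal]
  convert this using 1
  · ext n
    rw [← q_ofReal]; push_cast; rfl
  · norm_num

lemma integral_qr : ∫ x, qr x = 1 := by
  have h := integrable_qr.hasSum_intervalIntegral 0
  have h2 : HasSum (fun n : ℤ => ∫ x in (0:ℝ)..1, qr (x + n)) (∫ x in (0:ℝ)..1, (1:ℝ)) := by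
    refine intervalIntegral.hasSum_integral_of_dominated_convergence
      (bound := fun n x => qr (x + n)) ?_ ?_ ?_ ?_ ?_
    · intro n; exact (continuous_qr.comp (by fun_prop)).aestronglyMeasurable
    · intro n; exact Eventually.of_forall fun x _ => by
        rw [Real.norm_eq_abs, abs_of_nonneg (qr_nonneg _)]
    · exact Eventually.of_forall fun x _ => (hasSum_qr x).summable
    · simp_rw [(hasSum_qr _).tsum_eq]; exact intervalIntegrable_const
    · exact Eventually.of_forall fun x _ => hasSum_qr x
  have h3 : (fun n : ℤ => ∫ x in (0:ℝ) + n..0 + n + 1, qr x) = (fun n : ℤ => ∫ x in (0:ℝ)..1, qr (x + n)) := by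
    ext n
    rw [intervalIntegral.integral_comp_add_right]
    congr 1; ring
  rw [h3] at h
  simpa using h.unique h2

end SBound

namespace SBound

lemma vr_zero : vr 0 = 0 := by
  have := vr_neg 0
  simp [qr] at this
  linarith

lemma continuous_vr : Continuous vr :=
  continuous_iff_continuousAt.2 fun x => (hasDerivAt_vr x).continuousAt

lemma continuous_dvr : Continuous fun x : ℝ => (deriv V x).re := by
  have : Continuous (deriv V) := (differentiable_V.contDiff (n := 1)).continuous_deriv le_rfl
  fun_prop

/-- half mass -/
lemma half_mass (A : ℝ) (hA : 0 ≤ A) : ∫ x in (0:ℝ)..A, qr x ≤ 1 / 2 := by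
  have h1 : ∫ x in (-A)..0, qr x = ∫ x in (0:ℝ)..A, qr x := by
    have := intervalIntegral.integral_comp_neg (a := 0) (b := A) qr
    simp [qr_neg] at this
    exact this.symm
  have h2 : ∫ x in (-A)..A, qr x ≤ 1 := by
    rw [intervalIntegral.integral_of_le (by linarith), ← integral_qr]
    exact setIntegral_le_integral integrable_qr (Eventually.of_forall qr_nonneg)
  rw [← intervalIntegral.integral_add_adjacent_intervals (b := 0)
    (continuous_qr.intervalIntegrable _ _) (continuous_qr.intervalIntegrable _ _), h1] at h2
  linarith

lemma half_mass_scaled (Δ A : ℝ) (hΔ : 1 ≤ Δ) (hA : 0 ≤ A) : ∫ x in (0:ℝ)..A, qr (Δ * x) ≤ 1 / (2 * Δ) := by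
  rw [intervalIntegral.integral_comp_mul_left _ (by positivity)]
  have := half_mass (Δ * A) (by positivity)
  simp only [mul_zero, smul_eq_mul]
  calc Δ⁻¹ * ∫ x in (0:ℝ)..Δ * A, qr x ≤ Δ⁻¹ * (1 / 2) := by gcongr
    _ = _ := by field_simp

/-- the weight -/
noncomputable def wt (x : ℝ) : ℝ := Real.sqrt (1 + |x|)

lemma wt_pos (x : ℝ) : 0 < wt x := Real.sqrt_pos.2 (by positivity)
lemma one_le_wt (x : ℝ) : 1 ≤ wt x := Real.one_le_sqrt.2 (by linarith [abs_nonneg x])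
lemma wt_neg (x : ℝ) : wt (-x) = wt x := by simp [wt]
lemma wt_sq (x : ℝ) : wt x * wt x = 1 + |x| := Real.mul_self_sqrt (by positivity)
lemma continuous_wt : Continuous wt := by unfold wt; fun_prop

lemma integrable_wt : Integrable fun x : ℝ => wt x / (1 + x ^ 2) := by
  have h := (integrable_one_add_norm (E := ℝ) (μ := volume) (r := 3 / 2) (by norm_num)).const_mul 2
  refine h.mono' ?_ ?_
  · refine Continuous.aestronglyMeasurable (continuous_wt.div (by fun_prop) fun x => by positivity)
  · refine Eventually.of_forall fun x => ?_
    have hw := wt_pos x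
    rw [Real.norm_of_nonneg (by positivity), Real.norm_eq_abs]
    have hp : (1 + |x|) ^ (-(3 / 2) : ℝ) = wt x / (1 + |x|) ^ 2 := by
      rw [wt, Real.sqrt_eq_rpow, ← Real.rpow_natCast, ← Real.rpow_sub (by positivity)]
      norm_num
    rw [hp, ← mul_div_assoc, div_le_div_iff₀ (by positivity) (by positivity)]
    have : (1 + |x|) ^ 2 ≤ 2 * (1 + x ^ 2) := by
      rw [← sq_abs x]; nlinarith [sq_nonneg (|x| - 1)]
    nlinarith

lemma wt_tendsto : Tendsto (fun x : ℝ => wt x / (1 + x ^ 2)) atTop (nhds 0) := by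
  have h : Tendsto (fun x : ℝ => 2 / x) atTop (nhds 0) := tendsto_const_nhds.div_atTop tendsto_id
  refine squeeze_zero' (Eventually.of_forall fun x => by have := wt_pos x; positivity) ?_ h
  filter_upwards [eventually_ge_atTop 1] with x hx
  have h1 := one_le_wt x
  have h2 := wt_sq x
  rw [abs_of_pos (by linarith)] at h2
  rw [div_le_div_iff₀ (by positivity) (by positivity)]
  nlinarith

theorem one_sided : ∃ L : ℝ, ∀ (Δ : ℝ) (F F' : ℝ → ℝ) (a b B : ℝ), 1 ≤ Δ → 0 ≤ a → 0 ≤ b →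
    (∀ x, HasDerivAt F (F' x) x) → Continuous F' →
    (∀ x, -(a + b * wt x) ≤ F' x) → (∀ x, |F x| ≤ B * wt x) →
    F 0 ≤ (∫ x, Δ * (deriv V (-(Δ * x) : ℝ)).re * F x) + a / (2 * Δ) + L * b := by
  obtain ⟨K, hK0, hK⟩ := exists_derivV_bound
  refine ⟨∫ x, 2 * (wt x / (1 + x ^ 2)), ?_⟩
  intro Δ F F' a b B hΔ ha hb hF hF' hlow hgr
  have hΔ0 : 0 < Δ := by linarith
  have hFc : Continuous F := continuous_iff_continuousAt.2 fun x => (hF x).continuousAt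
  set φ : ℝ → ℝ := fun x => vr (-(Δ * x)) with hφ
  set ψ : ℝ → ℝ := fun x => Δ * (deriv V (-(Δ * x) : ℝ)).re with hψ
  have hφd : ∀ x, HasDerivAt φ (-ψ x) x := fun x => by
    have h1 : HasDerivAt (fun x : ℝ => -(Δ * x)) (-Δ) x := by
      have h := (hasDerivAt_id x).const_mul (-Δ)
      simp only [id, mul_one, neg_mul] at h; exact h
    have := (hasDerivAt_vr (-(Δ * x))).comp x h1
    refine this.congr_deriv ?_
    simp only [hψ]; ring
  have hφc : Continuous φ := continuous_vr.comp (by fun_prop)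
  have hψc : Continuous ψ := continuous_const.mul (continuous_dvr.comp (by fun_prop))
  have hφ0 : φ 0 = 0 := by simp [hφ, vr_zero]
  have hφneg : ∀ x, φ (-x) = vr (Δ * x) := fun x => by simp [hφ]
  have hφpos : ∀ x, 1 + φ x = qr (Δ * x) - vr (Δ * x) := fun x => by
    simp only [hφ]; rw [vr_neg]; ring
  have hv0 : ∀ x, 0 ≤ x → 0 ≤ vr (Δ * x) := fun x hx => by
    rcases hx.eq_or_lt with h | h
    · simp [← h, vr_zero]
    · exact vr_nonneg (by positivity)
  have hv1 : ∀ x, 0 ≤ x → vr (Δ * x) ≤ qr (Δ * x) := fun x hx => by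
    rcases hx.eq_or_lt with h | h
    · simp [← h, vr_zero, qr]
    · have := vr_le (x := Δ * x) (by positivity)
      linarith [qr_nonneg (Δ * x)]
  have hqle : ∀ x, qr (Δ * x) ≤ 2 / (1 + x ^ 2) := fun x => by
    refine (qr_le _).trans ?_
    have : x ^ 2 ≤ (Δ * x) ^ 2 := by
      rw [mul_pow]; nlinarith [sq_nonneg x, mul_nonneg (sq_nonneg x) (by nlinarith : 0 ≤ Δ ^ 2 - 1)]
    gcongr
  set w : ℝ → ℝ := fun x => a + b * wt x with hw
  have hwc : Continuous w := by have := continuous_wt; fun_prop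
  have hqc : Continuous fun x => qr (Δ * x) := continuous_qr.comp (by fun_prop)
  -- finite inequality
  have hfin : ∀ A : ℝ, 0 < A → F 0 ≤ ((1 + φ A) * F A - φ (-A) * F (-A)) + (∫ x in (-A)..A, ψ x * F x)
      + (a / (2 * Δ) + (∫ x, 2 * (wt x / (1 + x ^ 2))) * b) := by
    intro A hA
    have e1 : ∫ x in (0:ℝ)..A, (1 + φ x) * F' x = (1 + φ A) * F A - (1 + φ 0) * F 0 - ∫ x in (0:ℝ)..A, (-ψ x) * F x := by
      refine intervalIntegral.integral_mul_deriv_eq_deriv_mul (fun x _ => (hφd x).const_add 1) (fun x _ => hF x) ?_ ?_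
      · exact hψc.neg.intervalIntegrable _ _
      · exact hF'.intervalIntegrable _ _
    have e2 : ∫ x in (-A)..0, φ x * F' x = φ 0 * F 0 - φ (-A) * F (-A) - ∫ x in (-A)..0, (-ψ x) * F x := by
      refine intervalIntegral.integral_mul_deriv_eq_deriv_mul (fun x _ => (hφd x)) (fun x _ => hF x) ?_ ?_
      · exact hψc.neg.intervalIntegrable _ _
      · exact hF'.intervalIntegrable _ _
    have p1 : -∫ x in (0:ℝ)..A, (1 + φ x) * w x ≤ ∫ x in (0:ℝ)..A, (1 + φ x) * F' x := by
      rw [← intervalIntegral.integral_neg]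
      refine intervalIntegral.integral_mono_on hA.le ?_ ?_ ?_
      · exact Continuous.intervalIntegrable (by fun_prop) _ _
      · exact Continuous.intervalIntegrable (by fun_prop) _ _
      · intro x hx
        have h1 : 0 ≤ 1 + φ x := by rw [hφpos]; linarith [hv1 x hx.1]
        have := hlow x
        simp only [hw]; nlinarith
    have p2 : -∫ x in (-A)..0, φ x * w x ≤ ∫ x in (-A)..0, φ x * F' x := by
      rw [← intervalIntegral.integral_neg]
      refine intervalIntegral.integral_mono_on (by linarith) ?_ ?_ ?_
      · exact Continuous.intervalIntegrable (by fun_prop) _ _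
      · exact Continuous.intervalIntegrable (by fun_prop) _ _
      · intro x hx
        have h1 : 0 ≤ φ x := by
          have := hφneg (-x); rw [neg_neg] at this; rw [this]; exact hv0 _ (by linarith [hx.2])
        have := hlow x
        simp only [hw]; nlinarith
    have e3 : ∫ x in (-A)..0, φ x * w x = ∫ x in (0:ℝ)..A, vr (Δ * x) * w x := by
      have := intervalIntegral.integral_comp_neg (a := 0) (b := A) (fun x => φ x * w x)
      simp only [neg_zero] at this
      rw [← this]
      refine intervalIntegral.integral_congr fun x _ => ?_
      simp only [hφneg, hw, wt_neg]
    have e4 : (∫ x in (0:ℝ)..A, (1 + φ x) * w x) + (∫ x in (0:ℝ)..A, vr (Δ * x) * w x) = ∫ x in (0:ℝ)..A, qr (Δ * x) * w x := by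
      rw [← intervalIntegral.integral_add]
      · refine intervalIntegral.integral_congr fun x _ => ?_
        simp only [hφpos]; ring
      · exact Continuous.intervalIntegrable (by fun_prop) _ _
      · have := continuous_vr
        exact Continuous.intervalIntegrable (by fun_prop) _ _
    have e5 : ∫ x in (0:ℝ)..A, qr (Δ * x) * w x = a * (∫ x in (0:ℝ)..A, qr (Δ * x)) + b * ∫ x in (0:ℝ)..A, qr (Δ * x) * wt x := by
      have := continuous_wt
      rw [← intervalIntegral.integral_const_mul, ← intervalIntegral.integral_const_mul, ← intervalIntegral.integral_add]
      · refine intervalIntegral.integral_congr fun x _ => ?_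
        simp only [hw]; ring
      · exact Continuous.intervalIntegrable (by fun_prop) _ _
      · exact Continuous.intervalIntegrable (by fun_prop) _ _
    have e6 : ∫ x in (0:ℝ)..A, qr (Δ * x) * wt x ≤ ∫ x, 2 * (wt x / (1 + x ^ 2)) := by
      have h1 : ∫ x in (0:ℝ)..A, qr (Δ * x) * wt x ≤ ∫ x in (0:ℝ)..A, 2 * (wt x / (1 + x ^ 2)) := by
        have := continuous_wt
        refine intervalIntegral.integral_mono_on hA.le ?_ ?_ ?_
        · exact Continuous.intervalIntegrable (by fun_prop) _ _
        · exact (integrable_wt.const_mul 2).intervalIntegrable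
        · intro x _
          calc qr (Δ * x) * wt x ≤ 2 / (1 + x ^ 2) * wt x := by
                have := wt_pos x; gcongr; exact hqle x
            _ = _ := by ring
      refine h1.trans ?_
      rw [intervalIntegral.integral_of_le hA.le]
      refine setIntegral_le_integral (integrable_wt.const_mul 2) (Eventually.of_forall fun x => ?_)
      have := wt_pos x
      simp only [Pi.zero_apply]; positivity
    have e7 := half_mass_scaled Δ A hΔ hA.le
    have e8 : (∫ x in (-A)..0, (-ψ x) * F x) + (∫ x in (0:ℝ)..A, (-ψ x) * F x) = -∫ x in (-A)..A, ψ x * F x := by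
      rw [intervalIntegral.integral_add_adjacent_intervals, ← intervalIntegral.integral_neg]
      · refine intervalIntegral.integral_congr fun x _ => ?_
        simp only [neg_mul]
      · exact Continuous.intervalIntegrable (by fun_prop) _ _
      · exact Continuous.intervalIntegrable (by fun_prop) _ _
    rw [hφ0] at e1 e2
    have e9 : a * (∫ x in (0:ℝ)..A, qr (Δ * x)) ≤ a / (2 * Δ) := by
      calc _ ≤ a * (1 / (2 * Δ)) := by gcongr
        _ = _ := by ring
    have e10 := mul_le_mul_of_nonneg_left e6 hb
    linarith
  -- limit
  have hintg : Integrable fun x => ψ x * F x := by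
    have hB : 0 ≤ B := by
      have := hgr 0; have h2 := wt_pos 0
      by_contra h; push Not at h
      have := abs_nonneg (F 0); nlinarith
    refine (integrable_wt.const_mul (Δ * K * B)).mono' (by fun_prop) (Eventually.of_forall fun x => ?_)
    rw [norm_mul, Real.norm_eq_abs, Real.norm_eq_abs]
    have h1 : |ψ x| ≤ Δ * K / (1 + x ^ 2) := by
      simp only [hψ]; rw [abs_mul, abs_of_pos hΔ0, mul_div_assoc]
      gcongr
      refine (Complex.abs_re_le_norm _).trans ((hK _).trans ?_)
      simp only [Complex.ofReal_im, Complex.ofReal_re, abs_zero, mul_zero, Real.exp_zero, mul_one]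
      have h9 : x ^ 2 ≤ (-(Δ * x)) ^ 2 := by
        nlinarith [sq_nonneg x, mul_nonneg (sq_nonneg x) (by nlinarith : 0 ≤ Δ ^ 2 - 1)]
      exact div_le_div_of_nonneg_left hK0.le (by positivity) (by linarith)
    calc |ψ x| * |F x| ≤ Δ * K / (1 + x ^ 2) * (B * wt x) := by
          gcongr; exact hgr x
      _ = _ := by ring
  have hlim1 : Tendsto (fun A : ℝ => ∫ x in (-A)..A, ψ x * F x) atTop (nhds (∫ x, ψ x * F x)) :=
    intervalIntegral_tendsto_integral hintg tendsto_neg_atTop_atBot tendsto_id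
  have hlim2 : Tendsto (fun A : ℝ => (1 + φ A) * F A - φ (-A) * F (-A)) atTop (nhds 0) := by
    have hz : Tendsto (fun A : ℝ => 4 * B * (wt A / (1 + A ^ 2))) atTop (nhds 0) := by
      simpa using wt_tendsto.const_mul (4 * B)
    refine squeeze_zero_norm' ?_ hz
    filter_upwards [eventually_ge_atTop 0] with A hA
    have h1 := hv0 A hA
    have h2 := hv1 A hA
    have h3 := hqle A
    have h4 := hgr A
    have h5 := hgr (-A)
    rw [wt_neg] at h5
    rw [hφpos, hφneg, Real.norm_eq_abs]
    refine (abs_sub _ _).trans ?_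
    rw [abs_mul, abs_mul, abs_of_nonneg h1, abs_of_nonneg (by linarith : 0 ≤ qr (Δ * A) - vr (Δ * A))]
    have h6 : (qr (Δ * A) - vr (Δ * A)) * |F A| ≤ (2 / (1 + A ^ 2)) * (B * wt A) := by
      gcongr; linarith
    have h7 : (vr (Δ * A)) * |F (-A)| ≤ (2 / (1 + A ^ 2)) * (B * wt A) := by
      gcongr; linarith
    calc _ ≤ (2 / (1 + A ^ 2)) * (B * wt A) + (2 / (1 + A ^ 2)) * (B * wt A) := add_le_add h6 h7
      _ = _ := by ring
  have hlim := (hlim2.add hlim1).add_const (a / (2 * Δ) + (∫ x, 2 * (wt x / (1 + x ^ 2))) * b)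
  have := ge_of_tendsto hlim (by filter_upwards [eventually_gt_atTop 0] with A hA using hfin A hA)
  linarith

end SBound

namespace SBound

lemma integrable_line {f : ℂ → ℂ} {σ K : ℝ}
    (hf : ∀ z : ℂ, z.re = σ → DifferentiableAt ℂ f z)
    (hb : ∀ z : ℂ, z.re = σ → ‖f z‖ ≤ K * (wt z.im / (1 + z.im ^ 2))) :
    Integrable fun x : ℝ => f (σ + x * I) := by
  refine (integrable_wt.const_mul K).mono' ?_ (Eventually.of_forall fun x => ?_)
  · refine Continuous.aestronglyMeasurable (continuous_iff_continuousAt.2 fun x => ?_)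
    have h1 : ContinuousAt f (σ + x * I) := (hf _ (by simp)).continuousAt
    exact ContinuousAt.comp (f := fun x : ℝ => ((σ:ℂ) + x * I)) h1 (by fun_prop)
  · simpa using hb (σ + x * I) (by simp)

theorem strip_shift {f : ℂ → ℂ} {σ1 σ2 K : ℝ} (h : σ1 ≤ σ2)
    (hf : ∀ z : ℂ, σ1 ≤ z.re → z.re ≤ σ2 → DifferentiableAt ℂ f z)
    (hb : ∀ z : ℂ, σ1 ≤ z.re → z.re ≤ σ2 → ‖f z‖ ≤ K * (wt z.im / (1 + z.im ^ 2))) :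
    ∫ x : ℝ, f (σ1 + x * I) = ∫ x : ℝ, f (σ2 + x * I) := by
  have i1 : Integrable fun x : ℝ => f (σ1 + x * I) :=
    integrable_line (fun z hz => hf z hz.ge (hz.le.trans h)) (fun z hz => hb z hz.ge (hz.le.trans h))
  have i2 : Integrable fun x : ℝ => f (σ2 + x * I) :=
    integrable_line (fun z hz => hf z (h.trans hz.ge) hz.le) (fun z hz => hb z (h.trans hz.ge) hz.le)
  have l1 := intervalIntegral_tendsto_integral i1 tendsto_neg_atTop_atBot tendsto_id
  have l2 := intervalIntegral_tendsto_integral i2 tendsto_neg_atTop_atBot tendsto_id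
  have hd := l2.sub l1
  have hz : Tendsto (fun A : ℝ => 2 * K * |σ2 - σ1| * (wt A / (1 + A ^ 2))) atTop (nhds 0) := by
    simpa using wt_tendsto.const_mul (2 * K * |σ2 - σ1|)
  have h0 : Tendsto (fun A : ℝ => (∫ x in (-A)..A, f (σ2 + x * I)) - ∫ x in (-A)..A, f (σ1 + x * I)) atTop (nhds 0) := by
    refine squeeze_zero_norm' ?_ hz
    filter_upwards [eventually_ge_atTop 0] with A hA
    have := Complex.integral_boundary_rect_eq_zero_of_differentiableOn f (σ1 + (-A : ℝ) * I) (σ2 + (A : ℝ) * I) (by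
      intro z hz
      refine (hf z ?_ ?_).differentiableWithinAt
      · rw [mem_reProdIm] at hz; simp [Set.uIcc_of_le h] at hz; exact hz.1.1
      · rw [mem_reProdIm] at hz; simp [Set.uIcc_of_le h] at hz; exact hz.1.2)
    simp only [add_re, ofReal_re, mul_re, I_re, mul_zero, ofReal_im, I_im, mul_one, sub_zero, add_zero, add_im, mul_im, zero_add] at this
    have hI : I • ((∫ x in (-A)..A, f (σ2 + x * I)) - ∫ x in (-A)..A, f (σ1 + x * I)) =
      (∫ x in σ1..σ2, f (x + (A:ℝ) * I)) - (∫ x in σ1..σ2, f (x + (-A:ℝ) * I)) := by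
      rw [smul_sub]
      linear_combination this
    have hn : ‖(∫ x in (-A)..A, f (σ2 + x * I)) - ∫ x in (-A)..A, f (σ1 + x * I)‖ =
      ‖(∫ x in σ1..σ2, f (x + (A:ℝ) * I)) - (∫ x in σ1..σ2, f (x + (-A:ℝ) * I))‖ := by
      rw [← hI, norm_smul]; simp
    have hbd : ∀ B : ℝ, ‖∫ x in σ1..σ2, f (x + (B:ℝ) * I)‖ ≤ K * (wt B / (1 + B ^ 2)) * |σ2 - σ1| := by
      intro B
      refine intervalIntegral.norm_integral_le_of_norm_le_const fun x hx => ?_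
      rw [Set.uIoc_of_le h] at hx
      simpa using hb (x + B * I) (by simpa using hx.1.le) (by simpa using hx.2)
    rw [hn]
    refine (norm_sub_le _ _).trans ((add_le_add (hbd A) (hbd (-A))).trans (le_of_eq ?_))
    rw [wt_neg]; ring
  have := tendsto_nhds_unique hd h0
  exact (sub_eq_zero.1 this).symm

end SBound

namespace SBound

lemma hasDerivAt_cpow_real (c : ℂ) (y : ℝ) (hy : 0 < y) :
    HasDerivAt (fun y : ℝ => (y : ℂ) ^ c) (c * (y : ℂ) ^ (c - 1)) y := by
  have := (hasDerivAt_id (y : ℂ)).cpow_const (c := c) (by simpa using hy)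
  simpa using this.comp_ofReal

noncomputable def zt (n : ℕ) (s : ℂ) : ℂ :=
  (s - 1) * ((n + 1 : ℝ) : ℂ) ^ (-s) - (((n + 1 : ℝ) : ℂ) ^ (1 - s) - ((n + 1 + 1 : ℝ) : ℂ) ^ (1 - s))

lemma norm_zt_le (n : ℕ) (s : ℂ) (hs : 0 ≤ s.re) :
    ‖zt n s‖ ≤ ‖s - 1‖ * ‖s‖ * (n + 1 : ℝ) ^ (-s.re - 1) := by
  set N : ℝ := n + 1 with hN
  have hNpos : 0 < N := by positivity
  set M : ℝ := ‖s - 1‖ * ‖s‖ * N ^ (-s.re - 1) with hM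
  have hM0 : 0 ≤ M := by positivity
  have hconv : Convex ℝ (Set.Icc N (N + 1)) := convex_Icc _ _
  have hy : ∀ y ∈ Set.Icc N (N + 1), 0 < y := fun y hy => hNpos.trans_le hy.1
  have hd2 : ∀ y ∈ Set.Icc N (N + 1), ‖(1 - s) * (y : ℂ) ^ (-s) - (1 - s) * (N : ℂ) ^ (-s)‖ ≤ M := by
    intro y hyy
    have := hconv.norm_image_sub_le_of_norm_hasDerivWithin_le
      (f := fun y : ℝ => (1 - s) * (y : ℂ) ^ (-s)) (f' := fun y : ℝ => (1 - s) * (-s * (y : ℂ) ^ (-s - 1)))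
      (C := M) (x := N) (y := y)
      (fun x hx => ((hasDerivAt_cpow_real (-s) x (hy x hx)).const_mul (1 - s)).hasDerivWithinAt)
      (fun x hx => by
        rw [norm_mul, norm_mul, norm_neg, Complex.norm_cpow_eq_rpow_re_of_pos (hy x hx), hM, ← mul_assoc, norm_sub_rev 1 s]
        simp only [sub_re, neg_re, one_re]
        gcongr ?_ * ?_
        exact Real.rpow_le_rpow_of_nonpos hNpos hx.1 (by linarith))
      ⟨le_rfl, by linarith⟩ hyy
    refine this.trans ?_
    have : ‖y - N‖ ≤ 1 := by
      rw [Real.norm_eq_abs, abs_le]; constructor <;> linarith [hyy.1, hyy.2]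
    nlinarith
  have := hconv.norm_image_sub_le_of_norm_hasDerivWithin_le
      (f := fun y : ℝ => (y : ℂ) ^ (1 - s) - (y : ℂ) * ((1 - s) * (N : ℂ) ^ (-s)))
      (f' := fun y : ℝ => (1 - s) * (y : ℂ) ^ (-s) - (1 - s) * (N : ℂ) ^ (-s))
      (C := M) (x := N) (y := N + 1)
      (fun x hx => by
        have h1 := hasDerivAt_cpow_real (1 - s) x (hy x hx)
        rw [show (1 - s - 1 : ℂ) = -s by ring] at h1
        have h2 : HasDerivAt (fun y : ℝ => (y : ℂ) * ((1 - s) * (N : ℂ) ^ (-s))) ((1 - s) * (N : ℂ) ^ (-s)) x := by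
          simpa using (hasDerivAt_id (x : ℂ)).comp_ofReal.mul_const ((1 - s) * (N : ℂ) ^ (-s))
        exact (h1.sub h2).hasDerivWithinAt)
      hd2 ⟨le_rfl, by linarith⟩ ⟨by linarith, le_rfl⟩
  have e : zt n s = (((N + 1 : ℝ) : ℂ) ^ (1 - s) - ((N + 1 : ℝ) : ℂ) * ((1 - s) * (N : ℂ) ^ (-s))) -
      ((N : ℂ) ^ (1 - s) - (N : ℂ) * ((1 - s) * (N : ℂ) ^ (-s))) := by
    rw [zt, ← hN]; push_cast; ring
  rw [e]
  simpa using this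

lemma summable_zb {a : ℝ} (ha : 0 < a) : Summable fun n : ℕ => ((n : ℝ) + 1) ^ (-a - 1) := by
  have := (summable_nat_add_iff 1).2 (Real.summable_nat_rpow.2 (by linarith : -a - 1 < -1))
  simpa using this

lemma differentiable_zt (n : ℕ) : Differentiable ℂ (zt n) := by
  unfold zt
  have h1 : ((n + 1 : ℝ) : ℂ) ≠ 0 := by exact_mod_cast (by positivity : (0:ℝ) < n + 1).ne'
  have h2 : ((n + 1 + 1 : ℝ) : ℂ) ≠ 0 := by exact_mod_cast (by positivity : (0:ℝ) < n + 1 + 1).ne'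
  intro s
  refine ((differentiableAt_id.sub_const 1).mul ?_).sub (DifferentiableAt.sub ?_ ?_)
  · exact (differentiableAt_id.neg).const_cpow (Or.inl h1)
  · exact (differentiableAt_id.const_sub 1).const_cpow (Or.inl h1)
  · exact (differentiableAt_id.const_sub 1).const_cpow (Or.inl h2)

lemma norm_zt_le' {a : ℝ} (n : ℕ) (s : ℂ) (ha : 0 ≤ a) (hs : a ≤ s.re) :
    ‖zt n s‖ ≤ ‖s - 1‖ * ‖s‖ * (n + 1 : ℝ) ^ (-a - 1) := by
  refine (norm_zt_le n s (ha.trans hs)).trans ?_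
  gcongr
  linarith [(Nat.cast_nonneg n : (0:ℝ) ≤ n)]

lemma summable_zt {s : ℂ} (hs : 0 < s.re) : Summable fun n => zt n s :=
  Summable.of_norm_bounded ((summable_zb hs).mul_left _) fun n => norm_zt_le' n s hs.le le_rfl

lemma tsum_zt_of_one_lt {s : ℂ} (hs : 1 < s.re) : ∑' n, zt n s = riemannZeta₁ s - 1 := by
  have hs1 : s ≠ 1 := by rintro rfl; simp at hs
  have hz := zeta_eq_tsum_one_div_nat_add_one_cpow hs
  have hsum : Summable fun n : ℕ => 1 / ((n : ℂ) + 1) ^ s := by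
    have := (summable_nat_add_iff 1).2 (Complex.summable_one_div_nat_cpow.2 hs)
    simpa using this
  have h1 : HasSum (fun n : ℕ => (s - 1) * ((n + 1 : ℝ) : ℂ) ^ (-s)) ((s - 1) * riemannZeta s) := by
    have := hsum.hasSum.mul_left (s - 1)
    rw [← hz] at this
    refine this.congr_fun fun n => ?_
    rw [Complex.cpow_neg, one_div]; push_cast; rfl
  have h2 : Tendsto (fun n : ℕ => (((n + 1 : ℝ) : ℂ) ^ (1 - s))) atTop (nhds 0) := by
    rw [tendsto_zero_iff_norm_tendsto_zero]
    have : ∀ n : ℕ, ‖(((n + 1 : ℝ) : ℂ) ^ (1 - s))‖ = ((n : ℝ) + 1) ^ (-(s.re - 1)) := fun n => by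
      rw [Complex.norm_cpow_eq_rpow_re_of_pos (by positivity)]; simp
    simp_rw [this]
    exact (tendsto_rpow_neg_atTop (by linarith)).comp
      (tendsto_atTop_add_const_right _ _ tendsto_natCast_atTop_atTop)
  have h3 : Tendsto (fun N : ℕ => ∑ n ∈ Finset.range N, zt n s) atTop (nhds ((s - 1) * riemannZeta s - (1 - 0))) := by
    have e : ∀ N : ℕ, ∑ n ∈ Finset.range N, zt n s = (∑ n ∈ Finset.range N, (s - 1) * ((n + 1 : ℝ) : ℂ) ^ (-s))
        - (1 - ((N + 1 : ℝ) : ℂ) ^ (1 - s)) := by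
      intro N
      have := Finset.sum_range_sub' (fun n : ℕ => (((n + 1 : ℝ) : ℂ) ^ (1 - s))) N
      simp only [zt, Finset.sum_sub_distrib]
      rw [← Finset.sum_sub_distrib]
      congr 1
      push_cast at this ⊢
      rw [this]; simp
    simp_rw [e]
    exact h1.tendsto_sum_nat.sub (tendsto_const_nhds.sub h2)
  have h4 := (summable_zt (s := s) (by linarith)).hasSum.tendsto_sum_nat
  rw [tendsto_nhds_unique h4 h3, riemannZeta_eq_inv_sub_mul hs1]
  have : s - 1 ≠ 0 := sub_ne_zero.2 hs1
  field_simp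
  ring

lemma tsum_zt {s : ℂ} (hs : 0 < s.re) : ∑' n, zt n s = riemannZeta₁ s - 1 := by
  have hU : IsOpen {s : ℂ | 0 < s.re} := isOpen_lt continuous_const Complex.continuous_re
  have hd : DifferentiableOn ℂ (fun s => ∑' n, zt n s) {s : ℂ | 0 < s.re} := by
    intro z hz
    simp only [Set.mem_ofPred_eq] at hz
    -- local set
    set U : Set ℂ := {w : ℂ | z.re / 2 < w.re} ∩ Metric.ball 0 (‖z‖ + 1) with hUdef
    have hUo : IsOpen U := (isOpen_lt continuous_const Complex.continuous_re).inter Metric.isOpen_ball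
    have hzU : z ∈ U := ⟨by simp only [Set.mem_ofPred_eq]; linarith, by simp⟩
    have hdU : DifferentiableOn ℂ (fun s => ∑' n, zt n s) U := by
      refine differentiableOn_tsum_of_summable_norm
        (u := fun n : ℕ => (‖z‖ + 2) * (‖z‖ + 1) * ((n : ℝ) + 1) ^ (-(z.re / 2) - 1)) ?_ ?_ hUo ?_
      · exact (summable_zb (by linarith)).mul_left _
      · intro n; exact (differentiable_zt n).differentiableOn
      · intro n w hw
        have hw1 : z.re / 2 < w.re := by simpa using hw.1
        have hw2 : ‖w‖ < ‖z‖ + 1 := by simpa using hw.2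
        refine (norm_zt_le' n w (by linarith) hw1.le).trans ?_
        gcongr
        refine (norm_sub_le _ _).trans ?_
        rw [norm_one]; linarith
    exact (hdU.differentiableAt (hUo.mem_nhds hzU)).differentiableWithinAt
  have hA := hd.analyticOnNhd hU
  have hB : AnalyticOnNhd ℂ (fun s => riemannZeta₁ s - 1) {s : ℂ | 0 < s.re} :=
    (differentiable_riemannZeta₁.sub_const 1).differentiableOn.analyticOnNhd hU
  have hpre : IsPreconnected {s : ℂ | 0 < s.re} := (convex_halfSpace_re_gt 0).isPreconnected
  refine hA.eqOn_of_preconnected_of_eventuallyEq hB hpre (z₀ := 2) (by simp) ?_ (by simpa using hs)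
  have : {s : ℂ | 1 < s.re} ∈ nhds (2 : ℂ) := (isOpen_lt continuous_const Complex.continuous_re).mem_nhds (by simp)
  filter_upwards [this] with w hw
  exact tsum_zt_of_one_lt (by simpa using hw)

theorem zeta1_bound : ∃ C : ℝ, 1 ≤ C ∧ ∀ s : ℂ, 1 / 4 ≤ s.re → ‖riemannZeta₁ s‖ ≤ C * (1 + ‖s‖) ^ 2 := by
  refine ⟨1 + ∑' n : ℕ, ((n : ℝ) + 1) ^ (-(1/4) - 1 : ℝ), ?_, fun s hs => ?_⟩
  · have : 0 ≤ ∑' n : ℕ, ((n : ℝ) + 1) ^ (-(1/4) - 1 : ℝ) := tsum_nonneg fun n => by positivity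
    linarith
  have hT : 0 ≤ ∑' n : ℕ, ((n : ℝ) + 1) ^ (-(1/4) - 1 : ℝ) := tsum_nonneg fun n => by positivity
  set T := ∑' n : ℕ, ((n : ℝ) + 1) ^ (-(1/4) - 1 : ℝ)
  have h1 : ‖∑' n, zt n s‖ ≤ ‖s - 1‖ * ‖s‖ * T :=
    tsum_of_norm_bounded ((summable_zb (by norm_num)).hasSum.mul_left _) fun n => norm_zt_le' n s (by norm_num) hs
  rw [tsum_zt (by linarith)] at h1
  have h2 : ‖riemannZeta₁ s‖ ≤ ‖riemannZeta₁ s - 1‖ + 1 := by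
    simpa using norm_add_le (riemannZeta₁ s - 1) 1
  have h3 : ‖s - 1‖ ≤ ‖s‖ + 1 := by simpa using norm_sub_le s 1
  have h0 := norm_nonneg s
  have h4 : ‖s - 1‖ * ‖s‖ * T ≤ (1 + ‖s‖) ^ 2 * T := by
    have : ‖s - 1‖ * ‖s‖ ≤ (1 + ‖s‖) ^ 2 := by nlinarith
    gcongr
  nlinarith

end SBound

namespace SBound

noncomputable def av (n : ℕ) : ℂ := (ArithmeticFunction.vonMangoldt n : ℂ) / (Real.log n : ℂ)

lemma norm_av_le (n : ℕ) : ‖av n‖ ≤ 1 := by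
  rw [av, norm_div, Complex.norm_real, Complex.norm_real, Real.norm_of_nonneg ArithmeticFunction.vonMangoldt_nonneg,
    Real.norm_of_nonneg (Real.log_natCast_nonneg n)]
  exact div_le_one_of_le₀ ArithmeticFunction.vonMangoldt_le_log (Real.log_natCast_nonneg n)

lemma abscissa_av : LSeries.abscissaOfAbsConv av ≤ 1 := by
  apply LSeries.abscissaOfAbsConv_le_of_forall_lt_LSeriesSummable'
  intro y hy
  exact LSeriesSummable_of_bounded_of_one_lt_real (m := 1) (fun n _ => norm_av_le n) (by exact_mod_cast hy)

lemma abscissa_av_lt {s : ℂ} (hs : 1 < s.re) : LSeries.abscissaOfAbsConv av < s.re :=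
  abscissa_av.trans_lt (by exact_mod_cast hs)

lemma exp_LSeries_av {s : ℂ} (hs : 1 < s.re) : cexp (LSeries av s) = riemannZeta s :=
  riemannZeta_eq_exp_LSeries hs

lemma differentiableAt_LSeries_av {s : ℂ} (hs : 1 < s.re) : DifferentiableAt ℂ (LSeries av) s :=
  (LSeries_hasDerivAt (abscissa_av_lt hs)).differentiableAt

lemma isOpen_half (a : ℝ) : IsOpen {s : ℂ | a < s.re} := isOpen_lt continuous_const Complex.continuous_re

lemma mem_half {a : ℝ} {s : ℂ} : s ∈ {s : ℂ | a < s.re} ↔ a < s.re := by simp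

/-- nonvanishing -/
lemma zeta1_ne_zero (RH : ∀ ρ : ℂ, riemannZeta ρ = 0 → 0 ≤ ρ.re → ρ.re ≤ 1 → ρ.re = 1 / 2)
    {s : ℂ} (hs : 1 / 2 < s.re) : riemannZeta₁ s ≠ 0 := by
  intro h
  by_cases h1 : s = 1
  · subst h1; simp at h
  · have hz : riemannZeta s = 0 := by rw [riemannZeta_eq_inv_sub_mul h1, h, mul_zero]
    rcases le_or_gt s.re 1 with h2 | h2
    · have := RH s hz (by linarith) h2
      linarith
    · exact riemannZeta_ne_zero_of_one_le_re h2.le hz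

lemma exists_holo_log {G : ℂ → ℂ} {a : ℝ} (hG : ∀ s : ℂ, a < s.re → DifferentiableAt ℂ G s)
    (h0 : ∀ s : ℂ, a < s.re → G s ≠ 0) :
    ∃ f : ℂ → ℂ, (∀ s : ℂ, a < s.re → DifferentiableAt ℂ f s) ∧ ∀ s : ℂ, a < s.re → cexp (f s) = G s := by
  have hconv : Convex ℝ {s : ℂ | a < s.re} := convex_halfSpace_re_gt a
  have hne : ({s : ℂ | a < s.re}).Nonempty := ⟨((a + 1 : ℝ) : ℂ), by simp⟩
  have hsc : IsSimplyConnected {s : ℂ | a < s.re} := by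
    have := hconv.contractibleSpace hne
    exact SimplyConnectedSpace.ofContractible _
  have hcont : ContinuousOn G {s : ℂ | a < s.re} := fun s hs => (hG s (mem_half.1 hs)).continuousAt.continuousWithinAt
  obtain ⟨f, hfc, hf⟩ := exists_continuousOn_eqOn_exp_comp hsc (isOpen_half a) hcont (by
    rintro ⟨s, hs, h⟩; exact h0 s (mem_half.1 hs) h)
  refine ⟨f, fun s hs => ?_, fun s hs => hf (mem_half.2 hs)⟩
  have hfs : ContinuousAt f s := hfc.continuousAt ((isOpen_half a).mem_nhds (mem_half.2 hs))
  have hev : ∀ᶠ z in nhds s, f z = f s + Complex.log (G z / G s) := by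
    have h1 : ∀ᶠ z in nhds s, ‖f z - f s‖ < 1 := by
      have : Tendsto (fun z => ‖f z - f s‖) (nhds s) (nhds 0) := by
        simpa using (hfs.sub (continuousAt_const (y := f s))).norm.tendsto
      exact this.eventually_lt_const one_pos
    filter_upwards [h1, (isOpen_half a).mem_nhds (mem_half.2 hs)] with z hz1 hz2
    have him : |(f z - f s).im| < 1 := (Complex.abs_im_le_norm _).trans_lt hz1
    have hpi := Real.pi_gt_three
    rw [← hf hz2, ← hf (mem_half.2 hs)]
    simp only [Function.comp]
    rw [← Complex.exp_sub, Complex.log_exp]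
    · ring
    · linarith [(abs_lt.1 him).1]
    · linarith [(abs_lt.1 him).2]
  refine DifferentiableAt.congr_of_eventuallyEq ?_ hev
  refine (DifferentiableAt.clog ((hG s hs).div_const _) ?_).const_add _
  rw [div_self (h0 s hs)]; simp

theorem exists_g (RH : ∀ ρ : ℂ, riemannZeta ρ = 0 → 0 ≤ ρ.re → ρ.re ≤ 1 → ρ.re = 1 / 2) :
    ∃ g : ℂ → ℂ, (∀ s : ℂ, 1 / 2 < s.re → DifferentiableAt ℂ g s) ∧
      (∀ s : ℂ, 1 / 2 < s.re → cexp (g s) = riemannZeta₁ s / (s + 1)) ∧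
      (∀ s : ℂ, 1 < s.re → g s = LSeries av s + Complex.log (s - 1) - Complex.log (s + 1)) := by
  have hs1 : ∀ s : ℂ, 1 / 2 < s.re → s + 1 ≠ 0 := fun s hs h => by
    have := congrArg Complex.re h; simp at this; linarith
  obtain ⟨f, hfd, hf⟩ := exists_holo_log (G := fun s => riemannZeta₁ s / (s + 1)) (a := 1 / 2)
    (fun s hs => (differentiable_riemannZeta₁ s).div (by fun_prop) (hs1 s hs))
    (fun s hs => div_ne_zero (zeta1_ne_zero RH hs) (hs1 s hs))
  set B : ℂ → ℂ := fun s => LSeries av s + Complex.log (s - 1) - Complex.log (s + 1) with hB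
  have hBd : ∀ s : ℂ, 1 < s.re → DifferentiableAt ℂ B s := fun s hs => by
    refine ((differentiableAt_LSeries_av hs).add ?_).sub ?_
    · exact DifferentiableAt.clog (by fun_prop) (Or.inl (by simp; linarith))
    · exact DifferentiableAt.clog (by fun_prop) (Or.inl (by simp; linarith))
  have hBe : ∀ s : ℂ, 1 < s.re → cexp (B s) = riemannZeta₁ s / (s + 1) := fun s hs => by
    have h1 : s ≠ 1 := by rintro rfl; simp at hs
    have h2 : s - 1 ≠ 0 := sub_ne_zero.2 h1
    simp only [hB]
    rw [Complex.exp_sub, Complex.exp_add, exp_LSeries_av hs, Complex.exp_log h2,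
      Complex.exp_log (hs1 s (by linarith)), riemannZeta_eq_inv_sub_mul h1]
    field_simp
  have hpre : IsPreconnected {s : ℂ | 1 < s.re} := (convex_halfSpace_re_gt 1).isPreconnected
  obtain ⟨c, hc⟩ := (isOpen_half 1).exists_eq_add_of_deriv_eq (f := f) (g := B) hpre
    (fun s hs => (hfd s (by have := mem_half.1 hs; linarith)).differentiableWithinAt)
    (fun s hs => (hBd s (mem_half.1 hs)).differentiableWithinAt)
    (by
      intro s hs
      have hs' := mem_half.1 hs
      have hev : (fun z => cexp (f z)) =ᶠ[nhds s] fun z => cexp (B z) := by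
        filter_upwards [(isOpen_half 1).mem_nhds hs] with z hz
        have hz' := mem_half.1 hz
        rw [hBe z hz', hf z (by linarith)]
      have := hev.deriv_eq
      rw [deriv_cexp (hfd s (by linarith)), deriv_cexp (hBd s hs'), hf s (by linarith), hBe s hs'] at this
      exact mul_left_cancel₀ (div_ne_zero (zeta1_ne_zero RH (by linarith)) (hs1 s (by linarith))) this)
  have hexpc : cexp c = 1 := by
    have h2 := hc (mem_half.2 (by simp : (1:ℝ) < (2:ℂ).re))
    have h3 := hf 2 (by simp; norm_num)
    rw [h2] at h3
    simp only [Complex.exp_add] at h3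
    rw [hBe 2 (by simp)] at h3
    have h4 : riemannZeta₁ 2 / (2 + 1) ≠ 0 := div_ne_zero (zeta1_ne_zero RH (by simp; norm_num)) (hs1 2 (by simp; norm_num))
    exact mul_left_cancel₀ h4 (by rw [h3, mul_one])
  refine ⟨fun s => f s - c, fun s hs => (hfd s hs).sub_const c, fun s hs => ?_, fun s hs => ?_⟩
  · rw [Complex.exp_sub, hexpc, div_one, hf s hs]
  · have := hc (mem_half.2 hs)
    simp only [hB] at this
    simp only [this]; ring

end SBound

namespace SBound

structure IsG (g : ℂ → ℂ) : Prop where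
  diff : ∀ s : ℂ, 1 / 2 < s.re → DifferentiableAt ℂ g s
  exp_eq : ∀ s : ℂ, 1 / 2 < s.re → cexp (g s) = riemannZeta₁ s / (s + 1)
  eqD : ∀ s : ℂ, 1 < s.re → g s = LSeries av s + Complex.log (s - 1) - Complex.log (s + 1)

lemma log_diff_bound {s : ℂ} (hs : 1 < s.re) :
    ‖Complex.log (s - 1) - Complex.log (s + 1)‖ ≤ Real.log (1 + 2 / ‖s - 1‖) + π := by
  have h1 : 0 < ‖s - 1‖ := by
    have := Complex.abs_re_le_norm (s - 1)
    simp only [sub_re, one_re] at this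
    have h2 := le_abs_self (s.re - 1)
    linarith
  have h2 : ‖s - 1‖ ≤ ‖s + 1‖ := by
    rw [← sq_le_sq₀ (norm_nonneg _) (norm_nonneg _), Complex.sq_norm, Complex.sq_norm, normSq_apply, normSq_apply]
    simp; nlinarith
  have h3 : ‖s + 1‖ ≤ ‖s - 1‖ + 2 := by
    calc ‖s + 1‖ = ‖(s - 1) + 2‖ := by ring_nf
      _ ≤ _ := by simpa using norm_add_le (s - 1) 2
  refine (Complex.norm_le_abs_re_add_abs_im _).trans (add_le_add ?_ ?_)
  · rw [sub_re, Complex.log_re, Complex.log_re, abs_sub_comm, ← Real.log_div (h1.trans_le h2).ne' h1.ne',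
      abs_of_nonneg (Real.log_nonneg ((one_le_div h1).2 h2))]
    apply Real.log_le_log (div_pos (h1.trans_le h2) h1)
    rw [div_le_iff₀ h1, add_mul, div_mul_cancel₀ _ h1.ne']; linarith
  · rw [sub_im, Complex.log_im, Complex.log_im]
    have a1 := Complex.abs_arg_lt_pi_div_two_iff.2 (Or.inl (by simp; linarith : 0 < (s - 1).re))
    have a2 := Complex.abs_arg_lt_pi_div_two_iff.2 (Or.inl (by simp; linarith : 0 < (s + 1).re))
    refine (abs_sub _ _).trans ?_
    linarith

lemma LSeries_av_bound : ∃ A : ℝ, 0 ≤ A ∧ ∀ s : ℂ, 2 ≤ s.re → ‖LSeries av s‖ ≤ A := by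
  have hsum : Summable fun n : ℕ => (1 : ℝ) / (n : ℝ) ^ 2 := Real.summable_one_div_nat_pow.2 (by norm_num)
  refine ⟨∑' n : ℕ, (1 : ℝ) / (n : ℝ) ^ 2, tsum_nonneg fun n => by positivity, fun s hs => ?_⟩
  refine tsum_of_norm_bounded hsum.hasSum fun n => ?_
  rw [LSeries.norm_term_eq]
  split_ifs with h
  · simp [h]
  · have hn : (1 : ℝ) ≤ n := by exact_mod_cast Nat.one_le_iff_ne_zero.2 h
    gcongr
    · exact norm_av_le n
    · rw [← Real.rpow_natCast]
      exact Real.rpow_le_rpow_of_exponent_le hn (by simpa using hs)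

lemma log_le_wt (x : ℝ) : Real.log (6 + |x|) ≤ 7 * wt x := by
  have h1 : Real.log (6 + |x|) ≤ Real.log (6 * (wt x * wt x)) := by
    rw [wt_sq]; apply Real.log_le_log (by positivity); linarith [abs_nonneg x]
  have hw := wt_pos x
  rw [Real.log_mul (by norm_num) (by positivity), Real.log_mul hw.ne' hw.ne'] at h1
  have h2 := Real.log_le_sub_one_of_pos hw
  have h3 := Real.log_le_sub_one_of_pos (show (0:ℝ) < 6 by norm_num)
  have := one_le_wt x
  linarith

theorem growth_g {g : ℂ → ℂ} (hg : IsG g) {σ0 : ℝ} (hσ : 1 / 2 < σ0) :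
    ∃ B : ℝ, 0 ≤ B ∧ ∀ s : ℂ, σ0 ≤ s.re → ‖g s‖ ≤ B * wt s.im := by
  obtain ⟨A, hA0, hA⟩ := LSeries_av_bound
  obtain ⟨C, hC1, hC⟩ := zeta1_bound
  have hfar : ∀ s : ℂ, 2 ≤ s.re → ‖g s‖ ≤ A + 2 + π := fun s hs => by
    rw [hg.eqD s (by linarith), add_sub_assoc]
    refine (norm_add_le _ _).trans ?_
    have h1 := hA s hs
    have h2 := log_diff_bound (s := s) (by linarith)
    have h3 : 1 ≤ ‖s - 1‖ := by
      have := Complex.abs_re_le_norm (s - 1)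
      simp only [sub_re, one_re] at this
      have h2 := le_abs_self (s.re - 1)
      linarith
    have h4 : Real.log (1 + 2 / ‖s - 1‖) ≤ 2 := by
      have := Real.log_le_sub_one_of_pos (show (0:ℝ) < 1 + 2 / ‖s - 1‖ by positivity)
      have h5 : 2 / ‖s - 1‖ ≤ 2 := div_le_self (by norm_num) h3
      linarith
    linarith
  have hlogC : 0 ≤ Real.log C := Real.log_nonneg hC1
  set δ := σ0 - 1 / 2 with hδ
  have hδ0 : 0 < δ := by simp only [hδ]; linarith
  have hpi := Real.pi_pos
  refine ⟨(A + 2 + π) + ((3 * (Real.log C + 14)) + (A + 2 + π) * 3) / δ, by positivity, fun s hs => ?_⟩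
  have hw := one_le_wt s.im
  rcases le_or_gt 2 s.re with h2 | h2
  · refine (hfar s h2).trans ?_
    have h9 : 0 ≤ ((3 * (Real.log C + 14)) + (A + 2 + π) * 3) / δ := by positivity
    nlinarith
  set c : ℂ := 2 + s.im * I with hc
  set M : ℝ := Real.log (C * (6 + |s.im|) ^ 2) with hM
  have hM2 : M = Real.log C + 2 * Real.log (6 + |s.im|) := by
    rw [hM, Real.log_mul (by positivity) (by positivity), Real.log_pow]; norm_num
  have hlog6 : 0 < Real.log (6 + |s.im|) := Real.log_pos (by linarith [abs_nonneg s.im])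
  have hM0 : 0 < M := by rw [hM2]; linarith
  have hcre : ∀ z ∈ Metric.ball (0:ℂ) (3 / 2), 1 / 2 < (c + z).re := fun z hz => by
    have hz' : ‖z‖ < 3 / 2 := by simpa using hz
    have := (abs_le.1 (Complex.abs_re_le_norm z)).1
    simp [hc]; linarith
  have key := Complex.borelCaratheodory (f := fun z => g (c + z)) (M := M) (R := 3 / 2) (z := s - c) hM0
    (fun z hz => by
      have h1 : DifferentiableAt ℂ g (c + z) := hg.diff _ (hcre z hz)
      exact (h1.comp z (by fun_prop : DifferentiableAt ℂ (fun z => c + z) z)).differentiableWithinAt)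
    (fun z hz => by
      have h1 := hcre z hz
      have hz' : ‖z‖ < 3 / 2 := by simpa using hz
      have h2 := congrArg norm (hg.exp_eq _ h1)
      rw [Complex.norm_exp, norm_div] at h2
      have h3 : 1 ≤ ‖c + z + 1‖ := by
        have := Complex.abs_re_le_norm (c + z + 1)
        have h4 := le_abs_self (c + z + 1).re
        simp only [add_re, one_re] at this h4 h1
        linarith
      have h4 : ‖c + z‖ ≤ 5 + |s.im| := by
        have h5 := norm_add_le c z
        have h6 : ‖c‖ ≤ 2 + |s.im| := by
          simpa [hc] using norm_add_le (2:ℂ) (s.im * I)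
        linarith
      have h5 : Real.exp (g (c + z)).re ≤ C * (6 + |s.im|) ^ 2 := by
        rw [h2]
        refine (div_le_self (norm_nonneg _) h3).trans ((hC _ (by linarith)).trans ?_)
        have h7 : 1 + ‖c + z‖ ≤ 6 + |s.im| := by linarith
        gcongr
      have : (g (c + z)).re ≤ M := by
        rw [hM, Real.le_log_iff_exp_le (by positivity)]; exact h5
      simpa using this)
    (by norm_num)
    (by
      have : s - c = ((s.re - 2 : ℝ) : ℂ) := by apply Complex.ext <;> simp [hc]
      rw [this, mem_ball_zero_iff, Complex.norm_real, Real.norm_eq_abs, abs_lt]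
      constructor <;> linarith)
  simp only [add_sub_cancel, add_zero] at key
  have hn : ‖s - c‖ = 2 - s.re := by
    have : s - c = ((s.re - 2 : ℝ) : ℂ) := by apply Complex.ext <;> simp [hc]
    rw [this, Complex.norm_real, Real.norm_eq_abs, abs_of_neg (by linarith)]; ring
  rw [hn, ← add_div] at key
  have hgc : ‖g c‖ ≤ A + 2 + π := hfar c (by simp [hc])
  have hMw : M ≤ (Real.log C + 14) * wt s.im := by
    rw [hM2]; have := log_le_wt s.im; nlinarith
  refine key.trans ?_
  have hden : δ ≤ 3 / 2 - (2 - s.re) := by simp only [hδ]; linarith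
  have hnum : 2 * M * (2 - s.re) + ‖g c‖ * (3 / 2 + (2 - s.re)) ≤ ((3 * (Real.log C + 14)) + (A + 2 + π) * 3) * wt s.im := by
    have e1 : 2 * M * (2 - s.re) ≤ 3 * M := by nlinarith
    have e2 : ‖g c‖ * (3 / 2 + (2 - s.re)) ≤ (A + 2 + π) * 3 := by
      have := norm_nonneg (g c)
      nlinarith
    nlinarith
  calc _ ≤ (((3 * (Real.log C + 14)) + (A + 2 + π) * 3) * wt s.im) / δ := by
        have h0 : 0 ≤ ((3 * (Real.log C + 14)) + (A + 2 + π) * 3) * wt s.im := by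
          have := wt_pos s.im; positivity
        gcongr
    _ ≤ _ := by
        have h0 : 0 ≤ (A + 2 + π) * wt s.im := by
          have := wt_pos s.im; positivity
        have e : (A + 2 + π + (3 * (Real.log C + 14) + (A + 2 + π) * 3) / δ) * wt s.im =
          (A + 2 + π) * wt s.im + ((3 * (Real.log C + 14) + (A + 2 + π) * 3) * wt s.im) / δ := by ring
        rw [e]; linarith

end SBound

namespace SBound

lemma gamma_ratio_beta {a : ℂ} {h : ℝ} (ha : 1 ≤ a.re) (hh : 0 < h) :
    ‖Complex.Gamma a‖ ≤ ‖Complex.Gamma (a + h)‖ * (1 / (h * Real.Gamma h)) := by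
  have hb := Complex.Gamma_mul_Gamma_eq_betaIntegral (s := a) (t := h) (by linarith) (by simpa using hh)
  have hG : 0 < Real.Gamma h := Real.Gamma_pos_of_pos hh
  have hbd : ‖Complex.betaIntegral a h‖ ≤ 1 / h := by
    rw [Complex.betaIntegral]
    have hi : IntervalIntegrable (fun x : ℝ => (1 - x) ^ (h - 1)) volume 0 1 := by
      have := (intervalIntegral.intervalIntegrable_rpow' (a := 0) (b := 1) (r := h - 1) (by linarith)).comp_sub_left 1
      simpa using this.symm
    have h1 : ∫ x : ℝ in (0:ℝ)..1, (1 - x) ^ (h - 1) = 1 / h := by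
      rw [intervalIntegral.integral_comp_sub_left (fun x : ℝ => x ^ (h - 1)) 1, integral_rpow (Or.inl (by linarith))]
      simp [Real.zero_rpow hh.ne']
    rw [← h1]
    refine intervalIntegral.norm_integral_le_of_norm_le zero_le_one ?_ hi
    have hne : ∀ᵐ x : ℝ, x ≠ 1 := by
      rw [ae_iff]; simp
    filter_upwards [hne] with x hx1 hx
    have hx0 : 0 < x := hx.1
    have hx2 : 0 < 1 - x := by
      have := lt_of_le_of_ne hx.2 hx1; linarith
    rw [norm_mul, Complex.norm_cpow_eq_rpow_re_of_pos hx0]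
    have : (1 - (x:ℂ)) = ((1 - x : ℝ) : ℂ) := by push_cast; rfl
    rw [this, Complex.norm_cpow_eq_rpow_re_of_pos hx2]
    simp only [sub_re, one_re, ofReal_re]
    have h2 : x ^ (a.re - 1) ≤ 1 := Real.rpow_le_one hx0.le hx.2 (by linarith)
    have h3 : 0 ≤ (1 - x) ^ (h - 1) := by positivity
    nlinarith
  have hn := congrArg norm hb
  rw [norm_mul, norm_mul, Complex.Gamma_ofReal, Complex.norm_real, Real.norm_of_nonneg hG.le] at hn
  have : ‖Complex.Gamma a‖ = ‖Complex.Gamma (a + h)‖ * ‖Complex.betaIntegral a h‖ / Real.Gamma h := by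
    rw [← hn]; field_simp
  rw [this, mul_div_assoc]
  refine mul_le_mul_of_nonneg_left ?_ (norm_nonneg _)
  rw [div_le_iff₀ hG]
  refine hbd.trans (le_of_eq ?_)
  field_simp

lemma log_sum_aux (x y η : ℝ) (hx : 0 < x) (hη0 : 0 ≤ η) (hη : η ≤ 1) (n : ℕ) :
    Real.log ((x + n + 1) ^ 2 + y ^ 2) / 2 - Real.log ((x + 1) ^ 2 + y ^ 2) / 2 - (3 / 2) * ∑ j ∈ Finset.range n, 1 / ((j : ℝ) + 1) ^ 2
    ≤ ∑ j ∈ Finset.range n, (x + j) / ((x + j + η) ^ 2 + y ^ 2) := by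
  induction n with
  | zero => simp
  | succ n ih =>
    rw [Finset.sum_range_succ, Finset.sum_range_succ]
    set v := (x + n + 1) ^ 2 + y ^ 2 with hv
    have hn : (0:ℝ) ≤ n := Nat.cast_nonneg n
    have hv0 : 0 < v := by positivity
    set v' := (x + (n + 1 : ℕ) + 1) ^ 2 + y ^ 2 with hv'
    have hv'0 : 0 < v' := by positivity
    have hd : v' - v = 2 * (x + n) + 3 := by simp only [hv, hv']; push_cast; ring
    have h1 : Real.log v' ≤ Real.log v + (2 * (x + n) + 3) / v := by
      have := Real.log_le_sub_one_of_pos (div_pos hv'0 hv0)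
      rw [Real.log_div hv'0.ne' hv0.ne'] at this
      have e : v' / v - 1 = (2 * (x + n) + 3) / v := by rw [← hd]; field_simp
      linarith
    have h2 : (x + n) / v ≤ (x + n) / ((x + n + η) ^ 2 + y ^ 2) := by
      have : (x + n + η) ^ 2 + y ^ 2 ≤ v := by simp only [hv]; gcongr
      have h0 : 0 < (x + n + η) ^ 2 + y ^ 2 := by positivity
      gcongr
    have h3 : 1 / v ≤ 1 / ((n : ℝ) + 1) ^ 2 := by
      have : ((n : ℝ) + 1) ^ 2 ≤ v := by simp only [hv]; nlinarith [sq_nonneg y]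
      gcongr
    have e2 : (2 * (x + n) + 3) / v = 2 * ((x + n) / v) + 3 * (1 / v) := by ring
    linarith

lemma log_norm_step (a : ℂ) (j : ℕ) (η : ℝ) (ha : 0 < a.re) (hη0 : 0 ≤ η) :
    ‖a + j‖ ≤ ‖a + η + j‖ * Real.exp (-η * ((a.re + j) / ((a.re + j + η) ^ 2 + a.im ^ 2))) := by
  have hj : (0:ℝ) ≤ j := Nat.cast_nonneg j
  set u := (a.re + j) ^ 2 + a.im ^ 2 with hu
  set v := (a.re + j + η) ^ 2 + a.im ^ 2 with hv
  have hu0 : 0 < u := by positivity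
  have hv0 : 0 < v := by positivity
  have e1 : ‖a + j‖ ^ 2 = u := by rw [Complex.sq_norm, normSq_apply]; simp [hu]; ring
  have e2 : ‖a + η + j‖ ^ 2 = v := by rw [Complex.sq_norm, normSq_apply]; simp [hv]; ring
  have key : u ≤ v * Real.exp (-(2 * η * ((a.re + j) / v))) := by
    have h1 := Real.add_one_le_exp (-(2 * η * ((a.re + j) / v)))
    have h2 : u ≤ v * (-(2 * η * ((a.re + j) / v)) + 1) := by
      have : v * (-(2 * η * ((a.re + j) / v)) + 1) = v - 2 * η * (a.re + j) := by field_simp; ring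
      rw [this]; simp only [hu, hv]; nlinarith
    exact h2.trans (by gcongr)
  rw [← sq_le_sq₀ (norm_nonneg _) (by positivity), mul_pow, e1, e2, ← Real.exp_nat_mul]
  refine key.trans (le_of_eq ?_)
  congr 2; push_cast; ring

lemma gammaSeq_step : ∃ K : ℝ, ∀ (a : ℂ) (η : ℝ) (n : ℕ), 0 < a.re → 0 ≤ η → η ≤ 1 → 0 < n →
    ‖Complex.GammaSeq (a + η) n‖ ≤ ‖Complex.GammaSeq a n‖ * Real.exp (η * (Real.log (‖a‖ + 1) + K)) := by
  refine ⟨(3 / 2) * ∑' j : ℕ, 1 / ((j : ℝ) + 1) ^ 2, fun a η n ha hη0 hη hn => ?_⟩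
  set K := (3 / 2) * ∑' j : ℕ, 1 / ((j : ℝ) + 1) ^ 2 with hK
  have hn0 : (0:ℝ) < n := by exact_mod_cast hn
  have hprod : ∏ j ∈ Finset.range (n + 1), ‖a + j‖ ≤ (∏ j ∈ Finset.range (n + 1), ‖a + η + j‖) *
      Real.exp (-η * ∑ j ∈ Finset.range (n + 1), ((a.re + j) / ((a.re + j + η) ^ 2 + a.im ^ 2))) := by
    rw [Finset.mul_sum, Real.exp_sum, ← Finset.prod_mul_distrib]
    exact Finset.prod_le_prod (fun _ _ => norm_nonneg _) fun j _ => log_norm_step a j η ha hη0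
  have hsum := log_sum_aux a.re a.im η ha hη0 hη (n + 1)
  have hs2 : ∑ j ∈ Finset.range (n + 1), 1 / ((j : ℝ) + 1) ^ 2 ≤ ∑' j : ℕ, 1 / ((j : ℝ) + 1) ^ 2 :=
    summable_inv_sq.sum_le_tsum _ fun j _ => by positivity
  have hlogn : Real.log n ≤ Real.log ((a.re + (n + 1 : ℕ) + 1) ^ 2 + a.im ^ 2) / 2 := by
    have : Real.log ((n:ℝ) ^ 2) ≤ Real.log ((a.re + (n + 1 : ℕ) + 1) ^ 2 + a.im ^ 2) := by
      apply Real.log_le_log (by positivity)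
      push_cast
      nlinarith [sq_nonneg a.im]
    rw [Real.log_pow] at this
    push_cast at this ⊢; linarith
  have hloga : Real.log ((a.re + 1) ^ 2 + a.im ^ 2) / 2 ≤ Real.log (‖a‖ + 1) := by
    have : Real.log ((a.re + 1) ^ 2 + a.im ^ 2) ≤ Real.log ((‖a‖ + 1) ^ 2) := by
      apply Real.log_le_log (by positivity)
      have e : ‖a‖ ^ 2 = a.re ^ 2 + a.im ^ 2 := by rw [Complex.sq_norm, normSq_apply]; ring
      have := (le_abs_self _).trans (Complex.abs_re_le_norm a)
      nlinarith
    rw [Real.log_pow] at this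
    push_cast at this; linarith
  set T := ∑ j ∈ Finset.range (n + 1), ((a.re + j) / ((a.re + j + η) ^ 2 + a.im ^ 2)) with hT
  have hTlow : Real.log n - Real.log (‖a‖ + 1) - K ≤ T := by simp only [hK]; linarith
  have hne : ∀ b : ℂ, 0 < b.re → ∀ j : ℕ, 0 < ‖b + j‖ := fun b hb j => by
    rw [norm_pos_iff]; intro h
    have := congrArg Complex.re h; simp at this
    have hj : (0:ℝ) ≤ j := Nat.cast_nonneg j
    linarith
  have hP1 : 0 < ∏ j ∈ Finset.range (n + 1), ‖a + j‖ := Finset.prod_pos fun j _ => hne a ha j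
  have hP2 : 0 < ∏ j ∈ Finset.range (n + 1), ‖a + η + j‖ :=
    Finset.prod_pos fun j _ => hne (a + η) (by simp; linarith) j
  have en : ‖((n : ℕ) : ℂ) ^ (a + η)‖ = (n : ℝ) ^ a.re * Real.exp (η * Real.log n) := by
    rw [Complex.norm_natCast_cpow_of_pos hn]
    simp only [add_re, ofReal_re]
    rw [Real.rpow_add hn0, mul_comm η, ← Real.rpow_def_of_pos hn0]
  rw [Complex.GammaSeq, Complex.GammaSeq, norm_div, norm_div, norm_prod, norm_prod, norm_mul, norm_mul, en,
    Complex.norm_natCast_cpow_of_pos hn, div_mul_eq_mul_div, div_le_div_iff₀ hP2 hP1]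
  set P1 := ∏ j ∈ Finset.range (n + 1), ‖a + j‖
  set P2 := ∏ j ∈ Finset.range (n + 1), ‖a + η + j‖
  have hfin : Real.exp (η * Real.log n) * P1 ≤ P2 * Real.exp (η * (Real.log (‖a‖ + 1) + K)) := by
    calc Real.exp (η * Real.log n) * P1 ≤ Real.exp (η * Real.log n) * (P2 * Real.exp (-η * T)) := by gcongr
      _ = P2 * Real.exp (η * (Real.log n - T)) := by
        rw [mul_left_comm, ← Real.exp_add]; congr 2; ring
      _ ≤ _ := by gcongr; linarith
  have h0 : 0 ≤ (n:ℝ) ^ a.re * ‖((n.factorial : ℕ) : ℂ)‖ := by positivity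
  calc _ = ((n:ℝ) ^ a.re * ‖((n.factorial : ℕ) : ℂ)‖) * (Real.exp (η * Real.log n) * P1) := by ring
    _ ≤ ((n:ℝ) ^ a.re * ‖((n.factorial : ℕ) : ℂ)‖) * (P2 * Real.exp (η * (Real.log (‖a‖ + 1) + K))) := by gcongr
    _ = _ := by ring

theorem gamma_step : ∃ K : ℝ, 0 ≤ K ∧ ∀ (a : ℂ) (η : ℝ), 0 < a.re → 0 ≤ η → η ≤ 1 →
    ‖Complex.Gamma (a + η)‖ ≤ ‖Complex.Gamma a‖ * Real.exp (η * (Real.log (‖a‖ + 1) + K)) := by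
  obtain ⟨K, hK⟩ := gammaSeq_step
  refine ⟨max K 0, le_max_right _ _, fun a η ha hη0 hη => ?_⟩
  have h1 := (Complex.GammaSeq_tendsto_Gamma (a + η)).norm
  have h2 := ((Complex.GammaSeq_tendsto_Gamma a).norm).mul_const (Real.exp (η * (Real.log (‖a‖ + 1) + K)))
  have h3 : ‖Complex.Gamma (a + η)‖ ≤ ‖Complex.Gamma a‖ * Real.exp (η * (Real.log (‖a‖ + 1) + K)) :=
    le_of_tendsto_of_tendsto h1 h2 (by
      filter_upwards [eventually_gt_atTop 0] with n hn using hK a η n ha hη0 hη hn)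
  refine h3.trans ?_
  gcongr
  exact le_max_left _ _

end SBound

namespace SBound

noncomputable def XX (s : ℂ) : ℂ := riemannZeta₁ s * (π : ℂ) ^ (-s / 2) * Complex.Gamma (s / 2 + 1)

lemma XX_eq {s : ℂ} (hs : 0 < s.re) (h1 : s ≠ 1) :
    XX s = (s - 1) * (s / 2) * completedRiemannZeta s := by
  have h0 : s ≠ 0 := by rintro rfl; simp at hs
  have hz := riemannZeta_eq_inv_sub_mul h1
  rw [riemannZeta_def_of_ne_zero h0] at hz
  have hG := Gammaℝ_ne_zero_of_re_pos hs
  have h2 : s - 1 ≠ 0 := sub_ne_zero.mpr h1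
  have : riemannZeta₁ s = (s - 1) * (completedRiemannZeta s / Gammaℝ s) := by
    rw [hz]; field_simp
  rw [XX, this, Complex.Gamma_add_one _ (by simpa using h0)]
  have hd := Gammaℝ_def s
  calc _ = (s - 1) * (completedRiemannZeta s / Gammaℝ s) * (s / 2) * ((π : ℂ) ^ (-s / 2) * Complex.Gamma (s / 2)) := by ring
    _ = _ := by rw [← hd]; field_simp

lemma norm_pi_cpow (s : ℂ) : ‖(π : ℂ) ^ (-s / 2)‖ = π ^ (-s.re / 2) := by
  rw [Complex.norm_cpow_eq_rpow_re_of_pos Real.pi_pos]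
  congr 1
  have : (-s / 2) = -s / ((2:ℝ):ℂ) := by push_cast; rfl
  rw [this, Complex.div_ofReal_re]; simp

lemma norm_XX_conj {s : ℂ} (h1 : s ≠ 1) : ‖XX (starRingEnd ℂ s)‖ = ‖XX s‖ := by
  have h1' : starRingEnd ℂ s ≠ 1 := by
    intro h; apply h1
    have := congrArg (starRingEnd ℂ) h
    simpa using this
  have hz : riemannZeta₁ (starRingEnd ℂ s) = starRingEnd ℂ (riemannZeta₁ s) := by
    have a := riemannZeta_eq_inv_sub_mul h1
    have b := riemannZeta_eq_inv_sub_mul h1'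
    rw [riemannZeta_conj, a] at b
    have h2 : starRingEnd ℂ s - 1 ≠ 0 := sub_ne_zero.mpr h1'
    simp only [map_mul, map_inv₀, map_sub, map_one] at b
    exact (mul_left_cancel₀ (inv_ne_zero h2) b).symm
  have hg : starRingEnd ℂ s / 2 + 1 = starRingEnd ℂ (s / 2 + 1) := by simp [Complex.conj_ofNat]
  rw [XX, XX, hz, hg, Complex.Gamma_conj]
  simp only [norm_mul, norm_pi_cpow, RCLike.norm_conj, Complex.conj_re]

lemma norm_XX_one_sub {s : ℂ} (hs : 0 < s.re) (hs' : s.re < 1) : ‖XX (1 - s)‖ = ‖XX s‖ := by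
  rw [XX_eq hs (by rintro rfl; simp at hs'), XX_eq (by simpa using hs') (by
    intro h; have := congrArg re h; simp at this; linarith), completedRiemannZeta_one_sub]
  have : (1 - s - 1) * ((1 - s) / 2) = (s - 1) * (s / 2) := by ring
  rw [this]

lemma differentiableAt_XX {s : ℂ} (hs : 0 < s.re) : DifferentiableAt ℂ XX s := by
  unfold XX
  refine ((differentiable_riemannZeta₁ s).mul ?_).mul ?_
  · refine DifferentiableAt.const_cpow (by fun_prop) (Or.inl (by exact_mod_cast Real.pi_ne_zero))
  · refine DifferentiableAt.comp (g := Complex.Gamma) s (Complex.differentiableAt_Gamma _ ?_) (by fun_prop)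
    intro m h
    have := congrArg re h
    have h2 : (s/2).re = s.re / 2 := by
      have : s / 2 = s / ((2:ℝ):ℂ) := by push_cast; rfl
      rw [this, Complex.div_ofReal_re]
    simp only [add_re, h2, one_re, neg_re, natCast_re] at this
    have : (0:ℝ) ≤ m := Nat.cast_nonneg m
    linarith

lemma half_re (s : ℂ) : (s/2).re = s.re / 2 := by
  have : s / 2 = s / ((2:ℝ):ℂ) := by push_cast; rfl
  rw [this, Complex.div_ofReal_re]

lemma wt_le_one_add (x : ℝ) : wt x ≤ 1 + |x| := by
  have h1 := one_le_wt x
  have h2 := wt_sq x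
  nlinarith

lemma XX_ratio {g : ℂ → ℂ} (hg : IsG g) {h : ℝ} (hh : 0 < h) (hh' : h ≤ 1 / 4) {z : ℂ} (hz : 0 ≤ z.re) :
    ‖XX (1 / 2 + z - h)‖ ≤ ‖XX (1 / 2 + z + h)‖ := by
  have hre : ((1:ℂ)/2).re = 1 / 2 := by rw [half_re]; simp
  have hpre : ∀ z : ℂ, (1 / 2 + z - h).re = 1 / 2 + z.re - h := fun z => by simp
  have hqre : ∀ z : ℂ, (1 / 2 + z + h).re = 1 / 2 + z.re + h := fun z => by simp
  have z1ne : ∀ s : ℂ, 1 / 2 < s.re → riemannZeta₁ s ≠ 0 := by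
    intro s hs h0
    have := hg.exp_eq s hs
    rw [h0, zero_div] at this
    exact Complex.exp_ne_zero _ this
  have s1ne : ∀ s : ℂ, 0 < s.re → s + 1 ≠ 0 := by
    intro s hs h0
    have := congrArg re h0
    simp at this; linarith
  have z1eq : ∀ s : ℂ, 1 / 2 < s.re → riemannZeta₁ s = cexp (g s) * (s + 1) := by
    intro s hs
    rw [hg.exp_eq s hs]; field_simp [s1ne s (by linarith)]
  have Xne : ∀ z : ℂ, 0 ≤ z.re → XX (1 / 2 + z + h) ≠ 0 := by
    intro z hz
    have : 0 < (1 / 2 + z + h : ℂ).re := by rw [hqre]; linarith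
    refine mul_ne_zero (mul_ne_zero (z1ne _ (by rw [hqre]; linarith)) ?_) ?_
    · rw [Complex.cpow_ne_zero_iff]; left; exact_mod_cast Real.pi_ne_zero
    · apply Complex.Gamma_ne_zero_of_re_pos
      rw [add_re, half_re]; simp only [one_re]; linarith
  set R : ℂ → ℂ := fun z => XX (1 / 2 + z - h) / XX (1 / 2 + z + h) with hR
  have hcl : closure {z : ℂ | 0 < z.re} = {z : ℂ | 0 ≤ z.re} := by
    simp
  have hd : DiffContOnCl ℂ R {z : ℂ | 0 < z.re} := by
    apply DifferentiableOn.diffContOnCl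
    rw [hcl]
    intro z hz
    have hz : 0 ≤ z.re := hz
    apply DifferentiableAt.differentiableWithinAt
    refine DifferentiableAt.div ?_ ?_ (Xne z hz)
    · exact DifferentiableAt.comp (g := XX) z (differentiableAt_XX (by rw [hpre]; linarith)) (by fun_prop)
    · exact DifferentiableAt.comp (g := XX) z (differentiableAt_XX (by rw [hqre]; linarith)) (by fun_prop)
  -- growth
  obtain ⟨B, hB0, hB⟩ := growth_g hg (show 1 / 2 < 1 / 2 + h by linarith)
  obtain ⟨C, hC1, hC⟩ := zeta1_bound
  have hG : 0 < Real.Gamma h := Real.Gamma_pos_of_pos hh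
  set M := π ^ h * (1 / (h * Real.Gamma h)) with hM
  have hM0 : 0 ≤ M := by positivity
  have hRM : ∀ z : ℂ, 0 ≤ z.re → ‖R z‖ ≤ ‖riemannZeta₁ (1 / 2 + z - h)‖ / ‖riemannZeta₁ (1 / 2 + z + h)‖ * M := by
    intro z hz
    have hG2 : 0 < ‖Complex.Gamma ((1 / 2 + z + h) / 2 + 1)‖ := by
      rw [norm_pos_iff]; apply Complex.Gamma_ne_zero_of_re_pos
      rw [add_re, half_re, hqre]; simp only [one_re]; linarith
    have hGr := gamma_ratio_beta (a := (1 / 2 + z - h) / 2 + 1) (h := h) (by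
      rw [add_re, half_re, hpre]; simp only [one_re]; linarith) hh
    have e : (1 / 2 + z - h) / 2 + 1 + h = (1 / 2 + z + h) / 2 + 1 := by ring
    rw [e] at hGr
    have hz1 : 0 < ‖riemannZeta₁ (1 / 2 + z + h)‖ := by
      rw [norm_pos_iff]; exact z1ne _ (by rw [hqre]; linarith)
    rw [hR]
    simp only [XX, norm_div, norm_mul, norm_pi_cpow, hpre, hqre]
    have e2 : π ^ (-(1 / 2 + z.re - h) / 2) = π ^ (-(1 / 2 + z.re + h) / 2) * π ^ h := by
      rw [← Real.rpow_add Real.pi_pos]; congr 1; ring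
    rw [e2, hM]
    have hp : 0 < π ^ (-(1 / 2 + z.re + h) / 2) := by positivity
    rw [div_le_iff₀ (by positivity)]
    calc _ ≤ ‖riemannZeta₁ (1 / 2 + z - h)‖ * (π ^ (-(1 / 2 + z.re + h) / 2) * π ^ h) * (‖Complex.Gamma ((1 / 2 + z + h) / 2 + 1)‖ * (1 / (h * Real.Gamma h))) := by gcongr
      _ = _ := by
        generalize ‖riemannZeta₁ (1 / 2 + z - h)‖ = u1
        generalize ‖riemannZeta₁ (1 / 2 + z + h)‖ = u2 at hz1
        generalize ‖Complex.Gamma ((1 / 2 + z + h) / 2 + 1)‖ = u3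
        field_simp
  have hexp : ∃ c < (2 : ℝ), ∃ B, R =O[Bornology.cobounded ℂ ⊓ 𝓟 {z : ℂ | 0 < z.re}] fun z => Real.exp (B * ‖z‖ ^ c) := by
    refine ⟨1, by norm_num, 2 + B, ?_⟩
    refine Asymptotics.IsBigO.of_bound (C * Real.exp (4 + B) * M) ?_
    refine Filter.eventually_inf_principal.mpr (Filter.Eventually.of_forall ?_)
    intro z hz
    have hz : 0 ≤ z.re := le_of_lt hz
    have hq2 : 1 / 2 < (1 / 2 + z + h : ℂ).re := by rw [hqre]; linarith
    refine (hRM z hz).trans ?_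
    rw [Real.norm_of_nonneg (Real.exp_pos _).le, Real.rpow_one]
    have h1 := hC (1 / 2 + z - h) (by rw [hpre]; linarith)
    have h2 : 1 + ‖1 / 2 + z - h‖ ≤ 2 + ‖z‖ := by
      have : ‖1 / 2 + z - h‖ ≤ ‖(1 / 2 : ℂ)‖ + ‖z‖ + ‖(h:ℂ)‖ :=
        (norm_sub_le _ _).trans (add_le_add_left (norm_add_le _ _) _)
      rw [Complex.norm_real, Real.norm_of_nonneg hh.le] at this
      have h3 : ‖(1 / 2 : ℂ)‖ = 1 / 2 := by simp
      linarith
    have h3 : 2 + ‖z‖ ≤ Real.exp (2 + ‖z‖) := by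
      have := Real.add_one_le_exp (2 + ‖z‖); linarith
    have h4 : (1 + ‖1 / 2 + z - h‖) ^ 2 ≤ Real.exp (2 + ‖z‖) ^ 2 := by
      have := norm_nonneg (1 / 2 + z - h)
      exact pow_le_pow_left₀ (by linarith) (h2.trans h3) 2
    have h5 : 1 / ‖riemannZeta₁ (1 / 2 + z + h)‖ ≤ Real.exp (B * (1 + ‖z‖)) := by
      rw [z1eq _ hq2, norm_mul, Complex.norm_exp]
      have hb := hB (1 / 2 + z + h) (by rw [hqre]; linarith)
      have him : (1 / 2 + z + h : ℂ).im = z.im := by simp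
      rw [him] at hb
      have hw : wt z.im ≤ 1 + ‖z‖ := (wt_le_one_add _).trans (by linarith [Complex.abs_im_le_norm z])
      have hr : -(B * (1 + ‖z‖)) ≤ (g (1 / 2 + z + h)).re := by
        have := (Complex.abs_re_le_norm (g (1 / 2 + z + h))).trans (hb.trans (mul_le_mul_of_nonneg_left hw hB0))
        linarith [(abs_le.mp this).1]
      have hn1 : 1 ≤ ‖1 / 2 + z + h + 1‖ := by
        have := Complex.re_le_norm (1 / 2 + z + h + 1)
        rw [add_re, hqre, one_re] at this; linarith
      rw [div_le_iff₀ (by positivity)]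
      calc (1:ℝ) = Real.exp (B * (1 + ‖z‖)) * (Real.exp (-(B * (1 + ‖z‖))) * 1) := by
            rw [mul_one, ← Real.exp_add]; simp
        _ ≤ _ := by gcongr
    calc _ = ‖riemannZeta₁ (1 / 2 + z - h)‖ * (1 / ‖riemannZeta₁ (1 / 2 + z + h)‖) * M := by ring
      _ ≤ (C * Real.exp (2 + ‖z‖) ^ 2) * Real.exp (B * (1 + ‖z‖)) * M := by
        gcongr
        exact h1.trans (mul_le_mul_of_nonneg_left h4 (by linarith))
      _ = _ := by
        have : Real.exp (2 + ‖z‖) ^ 2 * Real.exp (B * (1 + ‖z‖)) = Real.exp (4 + B) * Real.exp ((2 + B) * ‖z‖) := by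
          rw [pow_two, ← Real.exp_add, ← Real.exp_add, ← Real.exp_add]; congr 1; ring
        linear_combination (C * M) * this
  have hreal : IsBoundedUnder (· ≤ ·) atTop fun x : ℝ => ‖R x‖ := by
    refine ⟨Real.exp (2 * (B * wt 0)) * M, ?_⟩
    rw [Filter.eventually_map]
    filter_upwards [eventually_ge_atTop (1:ℝ)] with x hx
    refine (hRM x (by simp; linarith)).trans (mul_le_mul_of_nonneg_right ?_ hM0)
    have hp2 : 1 / 2 < (1 / 2 + (x:ℂ) - h : ℂ).re := by rw [hpre]; simp only [ofReal_re]; linarith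
    have hq2 : 1 / 2 < (1 / 2 + (x:ℂ) + h : ℂ).re := by rw [hqre]; simp only [ofReal_re]; linarith
    have hb1 := hB (1 / 2 + x - h) (by rw [hpre]; simp only [ofReal_re]; linarith)
    have hb2 := hB (1 / 2 + x + h) (by rw [hqre]; simp only [ofReal_re]; linarith)
    have i1 : (1 / 2 + (x:ℂ) - h : ℂ).im = 0 := by simp
    have i2 : (1 / 2 + (x:ℂ) + h : ℂ).im = 0 := by simp
    rw [i1] at hb1; rw [i2] at hb2
    have r1 := (Complex.re_le_norm _).trans hb1
    have r2 := (abs_le.mp ((Complex.abs_re_le_norm _).trans hb2)).1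
    rw [z1eq _ hp2, z1eq _ hq2, norm_mul, norm_mul, Complex.norm_exp, Complex.norm_exp]
    have n1 : ‖1 / 2 + (x:ℂ) - h + 1‖ = 1 / 2 + x - h + 1 := by
      have : 1 / 2 + (x:ℂ) - h + 1 = ((1 / 2 + x - h + 1 : ℝ) : ℂ) := by push_cast; rfl
      rw [this, Complex.norm_real, Real.norm_of_nonneg (by linarith)]
    have n2 : ‖1 / 2 + (x:ℂ) + h + 1‖ = 1 / 2 + x + h + 1 := by
      have : 1 / 2 + (x:ℂ) + h + 1 = ((1 / 2 + x + h + 1 : ℝ) : ℂ) := by push_cast; rfl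
      rw [this, Complex.norm_real, Real.norm_of_nonneg (by linarith)]
    rw [n1, n2]
    have hx3 : 0 < 1 / 2 + x + h + 1 := by linarith
    rw [div_le_iff₀ (by positivity), ← mul_assoc, ← Real.exp_add]
    refine mul_le_mul (Real.exp_le_exp.mpr (by linarith)) (by linarith) (by linarith) (Real.exp_pos _).le
  have him : ∀ y : ℝ, ‖R (y * I)‖ ≤ 1 := by
    intro y
    have hy : (0:ℝ) ≤ ((y:ℂ) * I).re := by simp
    rw [hR]; simp only [norm_div]
    rw [div_le_one (by rw [norm_pos_iff]; exact Xne _ hy)]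
    have hp0 : 0 < (1 / 2 + (y:ℂ) * I - h : ℂ).re := by rw [hpre]; linarith
    have hp1 : (1 / 2 + (y:ℂ) * I - h : ℂ).re < 1 := by rw [hpre]; simp; linarith
    rw [← norm_XX_one_sub hp0 hp1, ← norm_XX_conj (s := 1 / 2 + (y:ℂ) * I + h)]
    · apply le_of_eq; congr 2
      simp [Complex.conj_ofNat]; ring
    · intro h0
      have := congrArg re h0
      rw [hqre] at this; simp at this; linarith
  have := PhragmenLindelof.right_half_plane_of_bounded_on_real hd hexp hreal him hz
  rw [hR] at this
  simp only [norm_div] at this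
  rwa [div_le_one (by rw [norm_pos_iff]; exact Xne _ hz)] at this

lemma XX_mono {g : ℂ → ℂ} (hg : IsG g) {δ : ℝ} (hδ : 0 < δ) (hδ' : δ ≤ 1 / 2) {s : ℂ} (hs : 1 / 2 < s.re) :
    ‖XX s‖ ≤ ‖XX (s + δ)‖ := by
  have := XX_ratio hg (h := δ / 2) (by linarith) (by linarith) (z := s - 1 / 2 + (δ / 2 : ℝ)) (by
    simp; linarith)
  convert this using 3
  · push_cast; ring
  · push_cast; ring
end SBound

namespace SBound

lemma re_g_step : ∃ K : ℝ, 0 ≤ K ∧ ∀ (g : ℂ → ℂ), IsG g → ∀ (δ : ℝ) (s : ℂ), 0 < δ → δ ≤ 1 / 2 → 1 / 2 < s.re →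
    (g s).re ≤ (g (s + δ)).re + δ * (1 + (Real.log (‖s / 2 + 1‖ + 1) + K) / 2) := by
  obtain ⟨K, hK0, hK⟩ := gamma_step
  refine ⟨K, hK0, ?_⟩
  intro g hg δ s hδ hδ' hs
  have hX := XX_mono hg hδ hδ' hs
  have hs2 : 1 / 2 < (s + δ).re := by simp; linarith
  have s1ne : ∀ s : ℂ, 0 < s.re → s + 1 ≠ 0 := by
    intro s hs h0
    have := congrArg re h0
    simp at this; linarith
  have z1eq : ∀ s : ℂ, 1 / 2 < s.re → riemannZeta₁ s = cexp (g s) * (s + 1) := by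
    intro s hs
    rw [hg.exp_eq s hs]; field_simp [s1ne s (by linarith)]
  have hare : 0 < (s / 2 + 1).re := by rw [add_re, half_re]; simp; linarith
  have hGs := hK (s / 2 + 1) (δ / 2) hare (by linarith) (by linarith)
  have e : s / 2 + 1 + ((δ / 2 : ℝ) : ℂ) = (s + δ) / 2 + 1 := by push_cast; ring
  rw [e] at hGs
  have hG0 : 0 < ‖Complex.Gamma (s / 2 + 1)‖ := by
    rw [norm_pos_iff]; exact Complex.Gamma_ne_zero_of_re_pos hare
  simp only [XX, z1eq s hs, z1eq _ hs2, norm_mul, norm_pi_cpow, Complex.norm_exp] at hX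
  have hn1 : 1 ≤ ‖s + 1‖ := by
    have := Complex.re_le_norm (s + 1)
    rw [add_re, one_re] at this; linarith
  have hn2 : ‖s + δ + 1‖ ≤ ‖s + 1‖ * Real.exp δ := by
    have : ‖s + δ + 1‖ ≤ ‖s + 1‖ + ‖(δ:ℂ)‖ := by
      have := norm_add_le (s + 1) (δ : ℂ)
      rwa [show s + 1 + (δ:ℂ) = s + δ + 1 by ring] at this
    rw [Complex.norm_real, Real.norm_of_nonneg hδ.le] at this
    have := Real.add_one_le_exp δ
    nlinarith
  have hp : π ^ (-(s + δ).re / 2) ≤ π ^ (-s.re / 2) := by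
    apply Real.rpow_le_rpow_of_exponent_le (by linarith [Real.pi_gt_three])
    simp; linarith
  have hp0 : 0 < π ^ (-s.re / 2) := by positivity
  set L := δ / 2 * (Real.log (‖s / 2 + 1‖ + 1) + K) with hL
  have h2 : Real.exp (g s).re * (‖s + 1‖ * π ^ (-s.re / 2) * ‖Complex.Gamma (s / 2 + 1)‖) ≤
      Real.exp ((g (s + δ)).re + δ + L) * (‖s + 1‖ * π ^ (-s.re / 2) * ‖Complex.Gamma (s / 2 + 1)‖) := by
    calc _ = Real.exp (g s).re * ‖s + 1‖ * π ^ (-s.re / 2) * ‖Complex.Gamma (s / 2 + 1)‖ := by ring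
      _ ≤ _ := hX
      _ ≤ Real.exp (g (s + δ)).re * (‖s + 1‖ * Real.exp δ) * π ^ (-s.re / 2) * (‖Complex.Gamma (s / 2 + 1)‖ * Real.exp L) := by
        gcongr
      _ = _ := by rw [Real.exp_add, Real.exp_add]; ring
  have h3 := le_of_mul_le_mul_right h2 (by positivity)
  have h4 := Real.exp_le_exp.mp h3
  rw [hL] at h4
  linarith

lemma re_deriv_g : ∃ K : ℝ, 0 ≤ K ∧ ∀ (g : ℂ → ℂ), IsG g → ∀ (s : ℂ), 1 / 2 < s.re →
    -(1 + (Real.log (‖s / 2 + 1‖ + 1) + K) / 2) ≤ (deriv g s).re := by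
  obtain ⟨K, hK0, hK⟩ := re_g_step
  refine ⟨K, hK0, ?_⟩
  intro g hg s hs
  have h1 : HasDerivAt (fun x : ℝ => g (s + x)) (deriv g s) 0 := by
    have a : HasDerivAt g (deriv g s) (s + (0:ℝ)) := by simpa using (hg.diff s hs).hasDerivAt
    have b : HasDerivAt (fun x : ℝ => s + (x:ℂ)) 1 0 := by
      simpa using ((hasDerivAt_id (0:ℝ)).ofReal_comp).const_add s
    exact (a.comp (0:ℝ) b).congr_deriv (by simp)
  have h2 : HasDerivAt (fun x : ℝ => (g (s + x)).re) (deriv g s).re 0 := by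
    have := (Complex.reCLM.hasFDerivAt.comp_hasDerivAt (0:ℝ) h1)
    exact this.congr_deriv (by simp)
  have h3 := h2.tendsto_slope_zero_right
  refine ge_of_tendsto h3 ?_
  have : Set.Ioc (0:ℝ) (1/2) ∈ nhdsWithin (0:ℝ) (Set.Ioi 0) := Ioc_mem_nhdsGT (by norm_num)
  filter_upwards [this] with δ hδ
  have h4 := hK g hg δ s hδ.1 hδ.2 hs
  have hδ0 : 0 < δ := hδ.1
  simp only [zero_add, ofReal_zero, add_zero, smul_eq_mul]
  rw [inv_mul_eq_div, le_div_iff₀ hδ0]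
  nlinarith

lemma re_deriv_g' : ∃ K : ℝ, 0 ≤ K ∧ ∀ (g : ℂ → ℂ), IsG g → ∀ (σ t x : ℝ), 1 / 2 < σ → σ ≤ 3 / 4 → 9 ≤ t →
    -((Real.log t / 2 + K) + wt x) ≤ (deriv g (σ + (t + x) * I)).re := by
  obtain ⟨K, hK0, hK⟩ := re_deriv_g
  refine ⟨1 + (Real.log 2 + K) / 2, by have := Real.log_nonneg (show (1:ℝ) ≤ 2 by norm_num); positivity, ?_⟩
  intro g hg σ t x hσ hσ' ht
  have h := hK g hg (σ + (t + x) * I) (by simpa using hσ)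
  refine le_trans ?_ h
  have hx0 := abs_nonneg x
  have hn : ‖((σ:ℂ) + (t + x) * I) / 2 + 1‖ + 1 ≤ 2 * t * (1 + |x|) := by
    have h1 : ‖((σ:ℂ) + (t + x) * I) / 2 + 1‖ ≤ σ / 2 + (t + |x|) / 2 + 1 := by
      have e : ((σ:ℂ) + (t + x) * I) / 2 + 1 = ((σ / 2 : ℝ):ℂ) + ((t / 2 : ℝ) : ℂ) * I + ((x / 2 : ℝ):ℂ) * I + ((1:ℝ):ℂ) := by
        push_cast; ring
      rw [e]
      refine (norm_add_le _ _).trans ?_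
      refine (add_le_add_left ((norm_add_le _ _).trans (add_le_add_left (norm_add_le _ _) _)) _).trans ?_
      simp only [norm_mul, Complex.norm_I, mul_one, Complex.norm_real, Real.norm_eq_abs, abs_div, abs_one]
      rw [abs_of_pos (show 0 < σ by linarith), abs_of_pos (show 0 < t by linarith), abs_of_pos (show (0:ℝ) < 2 by norm_num)]
      linarith
    nlinarith
  have hl : Real.log (‖((σ:ℂ) + (t + x) * I) / 2 + 1‖ + 1) ≤ Real.log 2 + Real.log t + 2 * wt x := by
    refine (Real.log_le_log (by positivity) hn).trans ?_
    rw [Real.log_mul (by positivity) (by positivity), Real.log_mul (by norm_num) (by positivity)]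
    have : Real.log (1 + |x|) ≤ 2 * wt x := by
      rw [← wt_sq x, Real.log_mul (wt_pos x).ne' (wt_pos x).ne']
      have := Real.log_le_sub_one_of_pos (wt_pos x)
      linarith
    linarith
  linarith
end SBound

namespace SBound

/-- the kernel -/
noncomputable def kk (Δ : ℝ) (w : ℂ) : ℂ := Δ * deriv V (I * Δ * w)

lemma differentiable_kk (Δ : ℝ) : Differentiable ℂ (kk Δ) := by
  unfold kk
  have h : Differentiable ℂ (deriv V) := by
    have := (differentiable_V.contDiff (n := 2)).differentiable_deriv_two
    exact this
  exact (h.comp (by fun_prop : Differentiable ℂ fun w : ℂ => I * Δ * w)).const_mul _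

lemma kk_bound : ∃ K : ℝ, 0 < K ∧ ∀ (Δ : ℝ) (w : ℂ), 0 ≤ Δ →
    ‖kk Δ w‖ ≤ K * Real.exp (2 * π * (Δ * |w.re|)) * (Δ * (1 + (Δ * w.im) ^ 2)⁻¹) := by
  obtain ⟨K, hK, h⟩ := exists_derivV_bound
  refine ⟨K, hK, fun Δ w hΔ => ?_⟩
  have := h (I * Δ * w)
  have e1 : (I * Δ * w).im = Δ * w.re := by simp
  have e2 : (I * Δ * w).re = -(Δ * w.im) := by simp
  rw [e1, e2, abs_mul, abs_of_nonneg hΔ, neg_sq] at this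
  rw [kk, norm_mul, Complex.norm_real, Real.norm_of_nonneg hΔ]
  calc _ ≤ Δ * _ := mul_le_mul_of_nonneg_left this hΔ
    _ = _ := by rw [div_eq_mul_inv]; ring

lemma kk_axis (Δ x : ℝ) : kk Δ ((0:ℝ) + x * I) = ((Δ * (deriv V ((-(Δ * x) : ℝ) : ℂ)).re : ℝ) : ℂ) := by
  have e : I * Δ * ((0:ℝ) + x * I) = ((-(Δ * x) : ℝ) : ℂ) := by
    push_cast
    linear_combination ((Δ : ℂ) * x) * I_mul_I
  rw [kk, e]
  rw [deriv_V_ofReal]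
  push_cast; rfl

lemma integrable_pois {Δ : ℝ} (hΔ : 0 < Δ) : Integrable fun x : ℝ => Δ * (1 + (Δ * x) ^ 2)⁻¹ :=
  ((integrable_comp_mul_left_iff _ hΔ.ne').mpr integrable_inv_one_add_sq).const_mul Δ

lemma integral_pois {Δ : ℝ} (hΔ : 0 < Δ) : ∫ x : ℝ, Δ * (1 + (Δ * x) ^ 2)⁻¹ = π := by
  rw [integral_const_mul, Measure.integral_comp_mul_left (fun x : ℝ => (1 + x ^ 2)⁻¹) Δ, integral_univ_inv_one_add_sq,
    abs_of_pos (inv_pos.mpr hΔ), smul_eq_mul]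
  field_simp

lemma wt_add_le (t x : ℝ) : wt (t + x) ≤ wt t * wt x := by
  unfold wt
  rw [← Real.sqrt_mul (by positivity)]
  apply Real.sqrt_le_sqrt
  have := abs_add_le t x
  nlinarith [mul_nonneg (abs_nonneg t) (abs_nonneg x)]

lemma pois_le {Δ : ℝ} (hΔ : 1 ≤ Δ) (x : ℝ) : (1 + (Δ * x) ^ 2)⁻¹ ≤ (1 + x ^ 2)⁻¹ := by
  apply inv_anti₀ (by positivity)
  have : 1 ≤ Δ ^ 2 := one_le_pow₀ hΔ
  nlinarith [sq_nonneg x]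

lemma norm_term_line {n : ℕ} (hn : n ≠ 0) (s : ℂ) : ‖LSeries.term av s n‖ ≤ (n:ℝ) ^ (-s.re) := by
  rw [LSeries.norm_term_eq, if_neg hn, Real.rpow_neg (Nat.cast_nonneg n), ← one_div]
  gcongr
  exact norm_av_le n

lemma differentiable_term (n : ℕ) : Differentiable ℂ fun s => LSeries.term av s n := by
  rcases eq_or_ne n 0 with rfl | hn
  · simp
  · have hn' : (n:ℂ) ≠ 0 := by exact_mod_cast hn
    simp only [LSeries.term_of_ne_zero hn]
    intro s
    refine (differentiableAt_const _).div (DifferentiableAt.const_cpow differentiableAt_id (Or.inl hn')) ?_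
    rw [Complex.cpow_ne_zero_iff]; exact Or.inl hn'

lemma term_integral : ∃ K : ℝ, 0 < K ∧ ∀ (Δ σ t η : ℝ) (n : ℕ), 1 ≤ Δ → 1 / 2 ≤ σ → 0 ≤ η → n ≠ 0 →
    ‖∫ x : ℝ, kk Δ (η + x * I) * LSeries.term av (σ + t * I + (η + x * I)) n‖ ≤
      if (n:ℝ) ≤ Real.exp (2 * π * Δ) then K * (n:ℝ) ^ (-(1/2:ℝ)) else 0 := by
  obtain ⟨K, hK, hk⟩ := kk_bound
  refine ⟨K * π, by positivity, ?_⟩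
  intro Δ σ t η n hΔ hσ hη hn
  have hn0 : (0:ℝ) < n := by exact_mod_cast Nat.pos_of_ne_zero hn
  have hn1 : (1:ℝ) ≤ n := by exact_mod_cast Nat.pos_of_ne_zero hn
  set f : ℂ → ℂ := fun w => kk Δ w * LSeries.term av (σ + t * I + w) n with hf
  have hfd : Differentiable ℂ f :=
    (differentiable_kk Δ).mul ((differentiable_term n).comp (by fun_prop : Differentiable ℂ fun w : ℂ => σ + t * I + w))
  have hfb : ∀ w : ℂ, 0 ≤ w.re → ‖f w‖ ≤ K * Real.exp (2 * π * (Δ * w.re)) * (n:ℝ) ^ (-(σ + w.re)) * (Δ * (1 + (Δ * w.im) ^ 2)⁻¹) := by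
    intro w hw
    have h1 := hk Δ w (by linarith)
    rw [abs_of_nonneg hw] at h1
    have h2 := norm_term_line hn (σ + t * I + w)
    have e : ((σ:ℂ) + t * I + w).re = σ + w.re := by simp
    rw [e] at h2
    rw [hf]; simp only [norm_mul]
    calc _ ≤ (K * Real.exp (2 * π * (Δ * w.re)) * (Δ * (1 + (Δ * w.im) ^ 2)⁻¹)) * (n:ℝ) ^ (-(σ + w.re)) := by
          gcongr
      _ = _ := by ring
  have hshift : ∀ Y : ℝ, 0 ≤ Y → ∫ x : ℝ, f ((0:ℝ) + x * I) = ∫ x : ℝ, f (Y + x * I) := by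
    intro Y hY
    refine strip_shift (K := K * Real.exp (2 * π * (Δ * Y)) * Δ) hY (fun z _ _ => hfd z) ?_
    intro z hz hz'
    refine (hfb z hz).trans ?_
    have h3 : (n:ℝ) ^ (-(σ + z.re)) ≤ 1 := Real.rpow_le_one_of_one_le_of_nonpos hn1 (by linarith)
    have h4 : (1 + (Δ * z.im) ^ 2)⁻¹ ≤ wt z.im / (1 + z.im ^ 2) := by
      refine (pois_le hΔ _).trans ?_
      rw [div_eq_mul_inv]
      have := one_le_wt z.im
      have : 0 < (1 + z.im ^ 2)⁻¹ := by positivity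
      nlinarith
    have h5 : 0 ≤ wt z.im / (1 + z.im ^ 2) := le_trans (by positivity) h4
    calc _ ≤ K * Real.exp (2 * π * (Δ * Y)) * 1 * (Δ * (wt z.im / (1 + z.im ^ 2))) := by
          gcongr
      _ = _ := by ring
  have hbd : ∀ Y : ℝ, 0 ≤ Y → ‖∫ x : ℝ, f (Y + x * I)‖ ≤ K * Real.exp (2 * π * (Δ * Y)) * (n:ℝ) ^ (-(σ + Y)) * π := by
    intro Y hY
    have hΔ0 : 0 < Δ := by linarith
    have hle : ‖∫ x : ℝ, f (Y + x * I)‖ ≤ ∫ x : ℝ, K * Real.exp (2 * π * (Δ * Y)) * (n:ℝ) ^ (-(σ + Y)) * (Δ * (1 + (Δ * x) ^ 2)⁻¹) := ?_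
    · rwa [integral_const_mul, integral_pois hΔ0] at hle
    refine norm_integral_le_of_norm_le ((integrable_pois hΔ0).const_mul _) (Eventually.of_forall fun x => ?_)
    have := hfb (Y + x * I) (by simpa using hY)
    simpa using this
  have hη' : (∫ x : ℝ, kk Δ (η + x * I) * LSeries.term av (σ + t * I + (η + x * I)) n) = ∫ x : ℝ, f ((0:ℝ) + x * I) :=
    (hshift η hη).symm
  rw [hη']
  split_ifs with hcase
  · have h := hbd 0 le_rfl
    simp only [mul_zero, Real.exp_zero, mul_one, add_zero] at h
    refine h.trans ?_
    have : (n:ℝ) ^ (-σ) ≤ (n:ℝ) ^ (-(1/2:ℝ)) := Real.rpow_le_rpow_of_exponent_le hn1 (by linarith)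
    calc _ ≤ K * (n:ℝ) ^ (-(1/2:ℝ)) * π := by gcongr
      _ = _ := by ring
  · push Not at hcase
    have hlog : 2 * π * Δ < Real.log n := (Real.lt_log_iff_exp_lt hn0).mpr hcase
    have hlim : Tendsto (fun Y : ℝ => K * π * (n:ℝ) ^ (-σ) * Real.exp (-((Real.log n - 2 * π * Δ) * Y))) atTop (nhds 0) := by
      have h1 : Tendsto (fun Y : ℝ => (Real.log n - 2 * π * Δ) * Y) atTop atTop :=
        tendsto_id.const_mul_atTop (by linarith)
      have := (Real.tendsto_exp_neg_atTop_nhds_zero.comp h1).const_mul (K * π * (n:ℝ) ^ (-σ))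
      simpa using this
    refine ge_of_tendsto hlim ?_
    filter_upwards [eventually_ge_atTop (0:ℝ)] with Y hY
    rw [hshift Y hY]
    refine (hbd Y hY).trans (le_of_eq ?_)
    rw [neg_add, Real.rpow_add hn0, Real.rpow_def_of_pos hn0 (-Y)]
    have : Real.exp (-((Real.log n - 2 * π * Δ) * Y)) = Real.exp (2 * π * (Δ * Y)) * Real.exp (Real.log n * -Y) := by
      rw [← Real.exp_add]; congr 1; ring
    rw [this]; ring

lemma sum_inv_sqrt (N : ℕ) : ∑ n ∈ Finset.range N, ((n + 1 : ℕ):ℝ) ^ (-(1/2:ℝ)) ≤ 2 * √N := by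
  induction N with
  | zero => simp
  | succ N ih =>
    rw [Finset.sum_range_succ]
    have e : ((N + 1 : ℕ):ℝ) ^ (-(1/2:ℝ)) = 1 / √((N + 1 : ℕ):ℝ) := by
      rw [Real.rpow_neg (by positivity), Real.sqrt_eq_rpow]; simp
    rw [e]
    have h1 : 0 < √((N + 1 : ℕ):ℝ) := by positivity
    have h2 := Real.sq_sqrt (show (0:ℝ) ≤ N by positivity)
    have h3 := Real.sq_sqrt (show (0:ℝ) ≤ ((N + 1 : ℕ):ℝ) by positivity)
    have h4 := Real.sqrt_nonneg (N:ℝ)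
    set a := √(N:ℝ)
    set b := √((N + 1 : ℕ):ℝ)
    have h5 : 1 / b ≤ 2 * b - 2 * a := by
      rw [div_le_iff₀ h1]
      push_cast at h3
      nlinarith [sq_nonneg (b - a)]
    linarith
end SBound

namespace SBound

lemma D_part : ∃ C : ℝ, 0 ≤ C ∧ ∀ (Δ σ t η : ℝ), 1 ≤ Δ → 1 / 2 ≤ σ → 0 ≤ η → 1 < σ + η →
    ‖∫ x : ℝ, kk Δ (η + x * I) * LSeries av (σ + t * I + (η + x * I))‖ ≤ C * Real.exp (π * Δ) := by
  obtain ⟨K, hK, hterm⟩ := term_integral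
  obtain ⟨K2, hK2, hk⟩ := kk_bound
  refine ⟨2 * K, by positivity, ?_⟩
  intro Δ σ t η hΔ hσ hη hση
  have hΔ0 : 0 < Δ := by linarith
  set F : ℕ → ℝ → ℂ := fun n x => kk Δ (η + x * I) * LSeries.term av (σ + t * I + (η + x * I)) n with hF
  set M := K2 * Real.exp (2 * π * (Δ * η)) with hM
  have hM0 : 0 ≤ M := by positivity
  have hFb : ∀ n x, ‖F n x‖ ≤ M * (n:ℝ) ^ (-(σ + η)) * (Δ * (1 + (Δ * x) ^ 2)⁻¹) := by
    intro n x
    rcases eq_or_ne n 0 with rfl | hn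
    · simp only [hF, LSeries.term_zero, mul_zero, norm_zero]; positivity
    have h1 := hk Δ (η + x * I) hΔ0.le
    have e1 : ((η:ℂ) + x * I).re = η := by simp
    have e2 : ((η:ℂ) + x * I).im = x := by simp
    rw [e1, e2, abs_of_nonneg hη] at h1
    have h2 := norm_term_line hn (σ + t * I + (η + x * I))
    have e : ((σ:ℂ) + t * I + (η + x * I)).re = σ + η := by simp
    rw [e] at h2
    simp only [hF, norm_mul]
    calc _ ≤ (K2 * Real.exp (2 * π * (Δ * η)) * (Δ * (1 + (Δ * x) ^ 2)⁻¹)) * (n:ℝ) ^ (-(σ + η)) := by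
          gcongr
      _ = _ := by rw [hM]; ring
  have hFi : ∀ n, Integrable (F n) := by
    intro n
    refine ((integrable_pois hΔ0).const_mul (M * (n:ℝ) ^ (-(σ + η)))).mono' ?_ (Eventually.of_forall (hFb n))
    apply Continuous.aestronglyMeasurable
    exact ((differentiable_kk Δ).continuous.comp (by fun_prop)).mul
      ((differentiable_term n).continuous.comp (by fun_prop))
  have hFs : Summable fun n => ∫ x, ‖F n x‖ := by
    have hs : Summable fun n : ℕ => M * (n:ℝ) ^ (-(σ + η)) * π :=
      ((Real.summable_nat_rpow.mpr (by linarith)).mul_left M).mul_right π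
    refine hs.of_nonneg_of_le (fun n => integral_nonneg fun x => norm_nonneg _) (fun n => ?_)
    rw [← integral_pois hΔ0, ← integral_const_mul]
    exact integral_mono (hFi n).norm ((integrable_pois hΔ0).const_mul _) (hFb n)
  have hsum := hasSum_integral_of_summable_integral_norm hFi hFs
  have hintg : (∫ x : ℝ, kk Δ (η + x * I) * LSeries av (σ + t * I + (η + x * I))) = ∫ x, ∑' n, F n x := by
    congr 1; ext x
    simp only [hF, LSeries, tsum_mul_left]
  rw [hintg, ← hsum.tsum_eq]
  set N := ⌊Real.exp (2 * π * Δ)⌋₊ with hN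
  set b : ℕ → ℝ := fun n => if n = 0 then 0 else if (n:ℝ) ≤ Real.exp (2 * π * Δ) then K * (n:ℝ) ^ (-(1/2:ℝ)) else 0 with hb
  have hbs : HasSum b (∑ n ∈ Finset.range (N + 1), b n) := by
    apply hasSum_sum_of_ne_finset_zero
    intro n hn
    rw [Finset.mem_range, not_lt] at hn
    have : ¬ (n:ℝ) ≤ Real.exp (2 * π * Δ) := by
      intro h
      have := (Nat.le_floor_iff (Real.exp_pos _).le).mpr h
      omega
    simp [hb, this]
  refine (tsum_of_norm_bounded hbs (fun n => ?_)).trans ?_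
  · rcases eq_or_ne n 0 with rfl | hn
    · simp [hb, hF]
    · simp only [hb, if_neg hn]
      exact hterm Δ σ t η n hΔ hσ hη hn
  · rw [Finset.sum_range_succ']
    have hb0 : b 0 = 0 := by simp [hb]
    rw [hb0, add_zero]
    have h1 : ∑ n ∈ Finset.range N, b (n + 1) ≤ ∑ n ∈ Finset.range N, K * ((n + 1 : ℕ):ℝ) ^ (-(1/2:ℝ)) := by
      apply Finset.sum_le_sum
      intro n _
      simp only [hb, Nat.add_one_ne_zero, if_false]
      split_ifs
      · exact le_rfl
      · positivity
    refine h1.trans ?_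
    rw [← Finset.mul_sum]
    have h2 := sum_inv_sqrt N
    have h3 : √(N:ℝ) ≤ Real.exp (π * Δ) := by
      rw [Real.sqrt_le_left (Real.exp_pos _).le, ← Real.exp_nat_mul]
      refine (Nat.floor_le (Real.exp_pos _).le).trans (le_of_eq ?_)
      congr 1; push_cast; ring
    nlinarith [mul_le_mul_of_nonneg_left (h2.trans (mul_le_mul_of_nonneg_left h3 zero_le_two)) hK.le]

lemma log_part : ∃ C : ℝ, 0 ≤ C ∧ ∀ (Δ σ t η : ℝ), 1 ≤ Δ → 1 / 2 ≤ σ → 0 ≤ η → σ + η = 1 + 1 / Δ → 9 ≤ t →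
    ‖∫ x : ℝ, kk Δ (η + x * I) * (Complex.log (σ + t * I + (η + x * I) - 1) - Complex.log (σ + t * I + (η + x * I) + 1))‖ ≤ C * Real.exp (π * Δ) := by
  obtain ⟨K, hK, hk⟩ := kk_bound
  refine ⟨K * Real.exp (2 * π) * ((2 + π) * π + 4 * π), by positivity, ?_⟩
  intro Δ σ t η hΔ hσ hη hση ht
  have hΔ0 : 0 < Δ := by linarith
  have hE : Real.exp (2 * π * (Δ * η)) ≤ Real.exp (2 * π) * Real.exp (π * Δ) := by
    rw [← Real.exp_add]
    apply Real.exp_le_exp.mpr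
    have : Δ * η ≤ Δ / 2 + 1 := by
      have : η = 1 + 1 / Δ - σ := by linarith
      rw [this]
      have : Δ * (1 + 1 / Δ - σ) = Δ + 1 - Δ * σ := by field_simp
      nlinarith
    nlinarith [Real.pi_pos]
  have hle : ‖∫ x : ℝ, kk Δ (η + x * I) * (Complex.log (σ + t * I + (η + x * I) - 1) - Complex.log (σ + t * I + (η + x * I) + 1))‖ ≤
      ∫ x : ℝ, K * (Real.exp (2 * π) * Real.exp (π * Δ)) * ((2 + π) * (Δ * (1 + (Δ * x) ^ 2)⁻¹) + 4 * (1 + x ^ 2)⁻¹) := ?_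
  · rw [integral_const_mul, integral_add ((integrable_pois hΔ0).const_mul _) (integrable_inv_one_add_sq.const_mul _),
      integral_const_mul, integral_pois hΔ0, integral_const_mul, integral_univ_inv_one_add_sq] at hle
    refine hle.trans (le_of_eq (by ring))
  refine norm_integral_le_of_norm_le ((((integrable_pois hΔ0).const_mul _).add (integrable_inv_one_add_sq.const_mul _)).const_mul _) (Eventually.of_forall fun x => ?_)
  have h1 := hk Δ (η + x * I) hΔ0.le
  have e1 : ((η:ℂ) + x * I).re = η := by simp
  have e2 : ((η:ℂ) + x * I).im = x := by simp
  rw [e1, e2, abs_of_nonneg hη] at h1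
  have hsre : ((σ:ℂ) + t * I + (η + x * I)).re = 1 + 1 / Δ := by rw [← hση]; simp
  have hsim : ((σ:ℂ) + t * I + (η + x * I)).im = t + x := by simp
  have hd0 : 0 < 1 / Δ := by positivity
  have h2 := log_diff_bound (s := σ + t * I + (η + x * I)) (by rw [hsre]; linarith)
  have hn1 : 1 / Δ ≤ ‖(σ:ℂ) + t * I + (η + x * I) - 1‖ := by
    have := Complex.re_le_norm ((σ:ℂ) + t * I + (η + x * I) - 1)
    rw [sub_re, hsre, one_re] at this; linarith
  have hn2 : |t + x| ≤ ‖(σ:ℂ) + t * I + (η + x * I) - 1‖ := by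
    have := Complex.abs_im_le_norm ((σ:ℂ) + t * I + (η + x * I) - 1)
    rwa [sub_im, hsim, one_im, sub_zero] at this
  generalize ‖(σ:ℂ) + t * I + (η + x * I) - 1‖ = r at *
  have hr0 : 0 < r := by linarith
  have hlog : Real.log (1 + 2 / r) ≤ 2 / r := by
    have := Real.log_le_sub_one_of_pos (show 0 < 1 + 2 / r by positivity)
    linarith
  have hP : 0 ≤ Δ * (1 + (Δ * x) ^ 2)⁻¹ := by positivity
  have key : (Δ * (1 + (Δ * x) ^ 2)⁻¹) * (Real.log (1 + 2 / r) + π) ≤ (2 + π) * (Δ * (1 + (Δ * x) ^ 2)⁻¹) + 4 * (1 + x ^ 2)⁻¹ := by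
    by_cases hc : 1 ≤ |t + x|
    · have : 2 / r ≤ 2 := by rw [div_le_iff₀ hr0]; linarith
      have : 0 ≤ 4 * (1 + x ^ 2)⁻¹ := by positivity
      nlinarith
    · push Not at hc
      have hx : 1 ≤ x ^ 2 := by
        have := (abs_lt.mp hc).2
        nlinarith
      have h5 : 2 / r ≤ 2 * Δ := by
        rw [div_le_iff₀ hr0]
        have := (div_le_iff₀ hΔ0).mp hn1
        nlinarith
      have h6 : (Δ * (1 + (Δ * x) ^ 2)⁻¹) * (2 * Δ) ≤ 4 * (1 + x ^ 2)⁻¹ := by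
        rw [← div_eq_mul_inv, ← div_eq_mul_inv, div_mul_eq_mul_div, div_le_div_iff₀ (by positivity) (by positivity)]
        nlinarith [sq_nonneg Δ, mul_le_mul_of_nonneg_left hx (sq_nonneg Δ)]
      nlinarith [mul_le_mul_of_nonneg_left (hlog.trans h5) hP]
  rw [norm_mul]
  calc _ ≤ (K * Real.exp (2 * π * (Δ * η)) * (Δ * (1 + (Δ * x) ^ 2)⁻¹)) * (Real.log (1 + 2 / r) + π) :=
        mul_le_mul h1 h2 (norm_nonneg _) (by positivity)
    _ = K * Real.exp (2 * π * (Δ * η)) * ((Δ * (1 + (Δ * x) ^ 2)⁻¹) * (Real.log (1 + 2 / r) + π)) := by ring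
    _ ≤ K * Real.exp (2 * π * (Δ * η)) * ((2 + π) * (Δ * (1 + (Δ * x) ^ 2)⁻¹) + 4 * (1 + x ^ 2)⁻¹) := by gcongr
    _ ≤ _ := by
      refine mul_le_mul_of_nonneg_right (mul_le_mul_of_nonneg_left hE hK.le) (by positivity)

end SBound

namespace SBound

lemma smooth_part : ∃ C : ℝ, 0 ≤ C ∧ ∀ g, IsG g → ∀ (Δ σ t : ℝ), 1 ≤ Δ → 1 / 2 < σ → σ ≤ 3 / 4 → 9 ≤ t →
    Integrable (fun x : ℝ => kk Δ ((0:ℝ) + x * I) * g (σ + t * I + ((0:ℝ) + x * I))) ∧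
    ‖∫ x : ℝ, kk Δ ((0:ℝ) + x * I) * g (σ + t * I + ((0:ℝ) + x * I))‖ ≤ C * Real.exp (π * Δ) := by
  obtain ⟨C1, hC1, hD⟩ := D_part
  obtain ⟨C2, hC2, hL⟩ := log_part
  obtain ⟨K, hK, hk⟩ := kk_bound
  refine ⟨C1 + C2, by positivity, ?_⟩
  intro g hg Δ σ t hΔ hσ hσ' ht
  have hΔ0 : 0 < Δ := by linarith
  obtain ⟨B, hB0, hB⟩ := growth_g hg hσ
  set η := 1 + 1 / Δ - σ with hη
  have hd0 : 0 < 1 / Δ := by positivity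
  have hη0 : 0 ≤ η := by linarith
  set f : ℂ → ℂ := fun w => kk Δ w * g (σ + t * I + w) with hf
  have hre : ∀ w : ℂ, ((σ:ℂ) + t * I + w).re = σ + w.re := fun w => by simp
  have him : ∀ w : ℂ, ((σ:ℂ) + t * I + w).im = t + w.im := fun w => by simp
  have hfd : ∀ w : ℂ, 0 ≤ w.re → DifferentiableAt ℂ f w := by
    intro w hw
    refine (differentiable_kk Δ w).mul ?_
    exact DifferentiableAt.comp (g := g) w (hg.diff _ (by rw [hre]; linarith)) (by fun_prop)
  have hfb : ∀ w : ℂ, 0 ≤ w.re → w.re ≤ η → ‖f w‖ ≤ (K * Real.exp (2 * π * (Δ * η)) * Δ * (B * wt t)) * (wt w.im / (1 + w.im ^ 2)) := by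
    intro w hw hw'
    have h1 := hk Δ w hΔ0.le
    rw [abs_of_nonneg hw] at h1
    have h2 := hB (σ + t * I + w) (by rw [hre]; linarith)
    rw [him] at h2
    have h3 := wt_add_le t w.im
    have h4 := pois_le hΔ w.im
    have := wt_pos t
    have := wt_pos w.im
    rw [hf]; simp only [norm_mul]
    calc _ ≤ (K * Real.exp (2 * π * (Δ * w.re)) * (Δ * (1 + (Δ * w.im) ^ 2)⁻¹)) * (B * wt (t + w.im)) :=
          mul_le_mul h1 h2 (norm_nonneg _) (by positivity)
      _ ≤ (K * Real.exp (2 * π * (Δ * η)) * (Δ * (1 + w.im ^ 2)⁻¹)) * (B * (wt t * wt w.im)) := by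
          have := wt_pos (t + w.im)
          gcongr
      _ = _ := by rw [div_eq_mul_inv]; ring
  have i0 : Integrable fun x : ℝ => f ((0:ℝ) + x * I) :=
    integrable_line (fun z hz => hfd z hz.ge) (fun z hz => hfb z hz.ge (hz.le.trans hη0))
  have i1 : Integrable fun x : ℝ => f (η + x * I) :=
    integrable_line (fun z hz => hfd z (hη0.trans hz.ge)) (fun z hz => hfb z (hη0.trans hz.ge) hz.le)
  refine ⟨i0, ?_⟩
  have hsh := strip_shift hη0 (fun z hz _ => hfd z hz) hfb
  have hgoal : (∫ x : ℝ, kk Δ ((0:ℝ) + x * I) * g (σ + t * I + ((0:ℝ) + x * I))) = ∫ x : ℝ, f (η + x * I) := hsh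
  rw [hgoal]
  have hre1 : ∀ x : ℝ, 1 < ((σ:ℂ) + t * I + (η + x * I)).re := by
    intro x; rw [hre]; simp; rw [hη]; linarith
  -- split
  set fD : ℝ → ℂ := fun x => kk Δ (η + x * I) * LSeries av (σ + t * I + (η + x * I)) with hfD
  set fL : ℝ → ℂ := fun x => kk Δ (η + x * I) * (Complex.log (σ + t * I + (η + x * I) - 1) - Complex.log (σ + t * I + (η + x * I) + 1)) with hfL
  have hsplit : ∀ x : ℝ, f (η + x * I) = fD x + fL x := by
    intro x
    simp only [hf, hfD, hfL]
    rw [hg.eqD _ (hre1 x)]; ring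
  have iL : Integrable fL := by
    have hbound : ∀ x, ‖fL x‖ ≤ (K * Real.exp (2 * π * (Δ * η)) * (2 * Δ + π)) * (Δ * (1 + (Δ * x) ^ 2)⁻¹) := by
      intro x
      have h1 := hk Δ (η + x * I) hΔ0.le
      have e1 : ((η:ℂ) + x * I).re = η := by simp
      have e2 : ((η:ℂ) + x * I).im = x := by simp
      rw [e1, e2, abs_of_nonneg hη0] at h1
      have h2 := log_diff_bound (hre1 x)
      have hn1 : 1 / Δ ≤ ‖(σ:ℂ) + t * I + (η + x * I) - 1‖ := by
        have := Complex.re_le_norm ((σ:ℂ) + t * I + (η + x * I) - 1)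
        rw [sub_re, hre, e1, one_re, hη] at this; linarith
      generalize ‖(σ:ℂ) + t * I + (η + x * I) - 1‖ = r at *
      have hr0 : 0 < r := by linarith
      have hlog : Real.log (1 + 2 / r) ≤ 2 * Δ := by
        have := Real.log_le_sub_one_of_pos (show 0 < 1 + 2 / r by positivity)
        have h5 : 2 / r ≤ 2 * Δ := by
          rw [div_le_iff₀ hr0]
          have := (div_le_iff₀ hΔ0).mp hn1
          nlinarith
        linarith
      rw [hfL]; simp only [norm_mul]
      calc _ ≤ (K * Real.exp (2 * π * (Δ * η)) * (Δ * (1 + (Δ * x) ^ 2)⁻¹)) * (2 * Δ + π) :=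
          mul_le_mul h1 (by linarith) (norm_nonneg _) (by positivity)
        _ = _ := by ring
    refine ((integrable_pois hΔ0).const_mul _).mono' ?_ (Eventually.of_forall hbound)
    apply Continuous.aestronglyMeasurable
    refine ((differentiable_kk Δ).continuous.comp (by fun_prop)).mul (Continuous.sub ?_ ?_)
    · refine Continuous.clog (by fun_prop) fun x => ?_
      left; have := hre1 x; rw [sub_re, one_re]; linarith
    · refine Continuous.clog (by fun_prop) fun x => ?_
      left; have := hre1 x; rw [add_re, one_re]; linarith
  have iD : Integrable fD := by
    have := i1.sub iL
    refine this.congr (Eventually.of_forall fun x => ?_)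
    simp only [Pi.sub_apply]
    rw [hsplit x]; ring
  have : (∫ x : ℝ, f (η + x * I)) = (∫ x, fD x) + ∫ x, fL x := by
    rw [← integral_add iD iL]; congr 1; ext x; exact hsplit x
  rw [this]
  refine (norm_add_le _ _).trans ?_
  have a1 := hD Δ σ t η hΔ hσ.le hη0 (by rw [hη]; linarith)
  have a2 := hL Δ σ t η hΔ hσ.le hη0 (by rw [hη]; ring) ht
  rw [add_mul]
  exact add_le_add a1 a2

theorem im_g_bound : ∃ C : ℝ, 0 ≤ C ∧ ∀ g, IsG g → ∀ (Δ σ t : ℝ), 1 ≤ Δ → 1 / 2 < σ → σ ≤ 3 / 4 → 9 ≤ t →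
    (1 / π) * (g (σ + t * I)).im ≤ Real.log t / (4 * π * Δ) + C * Real.exp (π * Δ) := by
  obtain ⟨C1, hC1, hS⟩ := smooth_part
  obtain ⟨K, hK, hKd⟩ := re_deriv_g'
  obtain ⟨L, hL⟩ := one_sided
  refine ⟨C1 + K + |L|, by positivity, ?_⟩
  intro g hg Δ σ t hΔ hσ hσ' ht
  have hΔ0 : 0 < Δ := by linarith
  have hpi := Real.pi_gt_three
  have hpi1 : 1 / π ≤ 1 := by rw [div_le_one (by linarith)]; linarith
  have hpi0 : 0 < 1 / π := by positivity
  obtain ⟨hi, hn⟩ := hS g hg Δ σ t hΔ hσ hσ' ht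
  obtain ⟨B, hB0, hB⟩ := growth_g hg hσ
  have hlogt : 0 ≤ Real.log t := Real.log_nonneg (by linarith)
  have hre : ∀ x : ℝ, 1 / 2 < ((σ:ℂ) + (t + x) * I).re := by intro x; simpa using hσ
  have hder : ∀ x : ℝ, HasDerivAt (fun x : ℝ => (1 / π) * (g (σ + (t + x) * I)).im) ((1 / π) * (deriv g (σ + (t + x) * I)).re) x := by
    intro x
    have a := (hg.diff _ (hre x)).hasDerivAt
    have b : HasDerivAt (fun x : ℝ => (σ:ℂ) + (t + x) * I) I x := by
      have := ((((hasDerivAt_id x).ofReal_comp).const_add (t:ℂ)).mul_const I).const_add (σ:ℂ)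
      simpa using this
    have c : HasDerivAt (fun x : ℝ => g ((σ:ℂ) + (t + x) * I)) (deriv g (σ + (t + x) * I) * I) x := a.comp x b
    have d : HasDerivAt (fun x : ℝ => (g ((σ:ℂ) + (t + x) * I)).im) (deriv g (σ + (t + x) * I)).re x :=
      (Complex.imCLM.hasFDerivAt.comp_hasDerivAt x c).congr_deriv (by simp)
    exact d.const_mul _
  have hcont : Continuous fun x : ℝ => (1 / π) * (deriv g (σ + (t + x) * I)).re := by
    have hdo : DifferentiableOn ℂ g {s : ℂ | 1 / 2 < s.re} := fun s hs => (hg.diff s (mem_half.mp hs)).differentiableWithinAt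
    have hdd := (hdo.deriv (isOpen_half _)).continuousOn
    have : Continuous fun x : ℝ => deriv g (σ + (t + x) * I) :=
      hdd.comp_continuous (by fun_prop) (fun x => mem_half.mpr (hre x))
    exact continuous_const.mul (Complex.continuous_re.comp this)
  have hmain := hL Δ (fun x : ℝ => (1 / π) * (g (σ + (t + x) * I)).im) (fun x : ℝ => (1 / π) * (deriv g (σ + (t + x) * I)).re)
    ((1 / π) * (Real.log t / 2 + K)) (1 / π) (B * wt t) hΔ (by positivity) (by positivity) hder hcont
    (by
      intro x
      have := mul_le_mul_of_nonneg_left (hKd g hg σ t x hσ hσ' ht) hpi0.le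
      refine le_trans (le_of_eq ?_) this
      ring)
    (by
      intro x
      have h1 := hB (σ + (t + x) * I) (by simp)
      have e : ((σ:ℂ) + (t + x) * I).im = t + x := by simp
      rw [e] at h1
      have h2 := (Complex.abs_im_le_norm (g (σ + (t + x) * I))).trans h1
      rw [abs_mul, abs_of_pos hpi0]
      have h3 := mul_le_mul_of_nonneg_left (wt_add_le t x) hB0
      have := abs_nonneg (g (σ + (t + x) * I)).im
      nlinarith)
  simp only [ofReal_zero, add_zero] at hmain
  have hintg : (∫ x : ℝ, Δ * (deriv V ((-(Δ * x) : ℝ) : ℂ)).re * ((1 / π) * (g (σ + (t + x) * I)).im)) =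
      (1 / π) * (∫ x : ℝ, kk Δ ((0:ℝ) + x * I) * g (σ + t * I + ((0:ℝ) + x * I))).im := by
    have := Complex.imCLM.integral_comp_comm hi
    simp only [Complex.imCLM_apply] at this
    rw [← this, ← integral_const_mul]
    congr 1; ext x
    rw [kk_axis, Complex.im_ofReal_mul]
    have e : (σ:ℂ) + t * I + ((0:ℝ) + x * I) = σ + (t + x) * I := by push_cast; ring
    rw [e]; ring
  rw [hintg] at hmain
  refine hmain.trans ?_
  have b1 := (Complex.im_le_norm _).trans hn
  have hexp1 : 1 ≤ Real.exp (π * Δ) := Real.one_le_exp (by positivity)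
  have b2 : (1 / π) * (∫ x : ℝ, kk Δ ((0:ℝ) + x * I) * g (σ + t * I + ((0:ℝ) + x * I))).im ≤ C1 * Real.exp (π * Δ) := by
    have h0 : 0 ≤ C1 * Real.exp (π * Δ) := by positivity
    refine (mul_le_mul_of_nonneg_left b1 hpi0.le).trans ?_
    nlinarith
  have b3 : (1 / π) * (Real.log t / 2 + K) / (2 * Δ) ≤ Real.log t / (4 * π * Δ) + K * Real.exp (π * Δ) := by
    have e : (1 / π) * (Real.log t / 2 + K) / (2 * Δ) = Real.log t / (4 * π * Δ) + K * ((1 / π) * (1 / (2 * Δ))) := by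
      field_simp; ring
    rw [e]
    have : (1 / π) * (1 / (2 * Δ)) ≤ 1 := by
      have : 1 / (2 * Δ) ≤ 1 := by rw [div_le_one (by linarith)]; linarith
      have : 0 ≤ 1 / (2 * Δ) := by positivity
      nlinarith
    have := mul_le_mul_of_nonneg_left (this.trans hexp1) hK
    linarith
  have b4 : L * (1 / π) ≤ |L| * Real.exp (π * Δ) := by
    refine (mul_le_mul_of_nonneg_right (le_abs_self L) hpi0.le).trans ?_
    exact mul_le_mul_of_nonneg_left (hpi1.trans hexp1) (abs_nonneg L)
  linarith
end SBound

namespace SBound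

lemma LSeries_av_tendsto (t : ℝ) : Tendsto (fun σ : ℝ => LSeries av (σ + t * I)) atTop (nhds 0) := by
  set f : ℕ → ℂ := fun n => (‖av n‖ : ℂ) with hf
  have hfa : LSeries.abscissaOfAbsConv f ≤ 1 :=
    LSeries.abscissaOfAbsConv_le_of_le_const ⟨1, fun n _ => by simpa [hf] using norm_av_le n⟩
  have h1 := LSeries.tendsto_atTop (f := f) (hfa.trans_lt (by exact_mod_cast EReal.coe_lt_top 1))
  have hf1 : f 1 = 0 := by simp [hf, av]
  rw [hf1] at h1
  have h2 := h1.norm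
  rw [norm_zero] at h2
  refine squeeze_zero_norm' ?_ h2
  filter_upwards [eventually_gt_atTop (1:ℝ)] with σ hσ
  have hs : LSeriesSummable av (σ + t * I) :=
    LSeriesSummable_of_abscissaOfAbsConv_lt_re (abscissa_av_lt (by simpa using hσ))
  have hterm : ∀ n, LSeries.term f σ n = (‖LSeries.term av (σ + t * I) n‖ : ℂ) := by
    intro n
    rcases eq_or_ne n 0 with rfl | hn
    · simp
    rw [LSeries.norm_term_eq, if_neg hn, LSeries.term_of_ne_zero hn, hf]
    simp only [add_re, ofReal_re, mul_re, I_re, mul_zero, ofReal_im, I_im, mul_one, sub_self, add_zero]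
    rw [Complex.ofReal_div, Complex.ofReal_cpow (Nat.cast_nonneg n)]
    simp
  have hL : LSeries f σ = ((∑' n, ‖LSeries.term av (σ + t * I) n‖ : ℝ) : ℂ) := by
    rw [LSeries, Complex.ofReal_tsum]
    exact tsum_congr hterm
  rw [hL, Complex.norm_real, Real.norm_of_nonneg (tsum_nonneg fun n => norm_nonneg _)]
  exact norm_tsum_le_tsum_norm hs.norm

lemma hasDerivAt_logZeta {g : ℂ → ℂ} (hg : IsG g) {s : ℂ} (hs : 1 / 2 < s.re) (hi : s.im ≠ 0) :
    HasDerivAt (fun s => g s + Complex.log (s + 1) - Complex.log (s - 1)) (deriv riemannZeta s / riemannZeta s) s := by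
  set G : ℂ → ℂ := fun s => g s + Complex.log (s + 1) - Complex.log (s - 1) with hG
  have hGd : DifferentiableAt ℂ G s := by
    refine ((hg.diff s hs).add ?_).sub ?_
    · refine DifferentiableAt.clog (by fun_prop) ?_
      right; simpa using hi
    · refine DifferentiableAt.clog (by fun_prop) ?_
      right; simpa using hi
  have hev : ∀ᶠ z in nhds s, riemannZeta z = cexp (G z) := by
    have o1 : {z : ℂ | 1 / 2 < z.re} ∈ nhds s := (isOpen_half _).mem_nhds (mem_half.mpr hs)
    have o2 : {z : ℂ | z.im ≠ 0} ∈ nhds s := (isOpen_ne_fun Complex.continuous_im continuous_const).mem_nhds hi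
    filter_upwards [o1, o2] with z hz hz2
    have hz : 1 / 2 < z.re := mem_half.mp hz
    have hz2 : z.im ≠ 0 := hz2
    have n1 : z + 1 ≠ 0 := by intro h; apply hz2; simpa using congrArg im h
    have n2 : z - 1 ≠ 0 := by intro h; apply hz2; simpa using congrArg im h
    rw [hG]; simp only
    rw [Complex.exp_sub, Complex.exp_add, Complex.exp_log n1, Complex.exp_log n2, hg.exp_eq z hz,
      riemannZeta_eq_inv_sub_mul (sub_ne_zero.mp n2)]
    field_simp
  have hd : deriv riemannZeta s = cexp (G s) * deriv G s := by
    rw [Filter.EventuallyEq.deriv_eq hev]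
    exact (hGd.hasDerivAt.cexp).deriv
  have : deriv riemannZeta s / riemannZeta s = deriv G s := by
    rw [hd, hev.self_of_nhds]; field_simp [Complex.exp_ne_zero]
  rw [this]
  exact hGd.hasDerivAt

lemma S_integral_bound : ∃ C : ℝ, 0 ≤ C ∧ ∀ g, IsG g → ∀ (Δ t : ℝ), 1 ≤ Δ → 9 ≤ t →
    -(1 / π) * (∫ σ in Set.Ioi (1 / 2 : ℝ), (deriv riemannZeta (σ + t * I) / riemannZeta (σ + t * I)).im) ≤
      Real.log t / (4 * π * Δ) + C * Real.exp (π * Δ) := by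
  obtain ⟨C, hC0, hC⟩ := im_g_bound
  refine ⟨C + 2, by positivity, ?_⟩
  intro g hg Δ t hΔ ht
  have hΔ0 : 0 < Δ := by linarith
  have hlogt : 0 ≤ Real.log t := Real.log_nonneg (by linarith)
  have hexp1 : 1 ≤ Real.exp (π * Δ) := Real.one_le_exp (by positivity)
  set φ : ℝ → ℝ := fun σ => (deriv riemannZeta (σ + t * I) / riemannZeta (σ + t * I)).im with hφ
  by_cases hintg : IntegrableOn φ (Set.Ioi (1 / 2 : ℝ))
  swap
  · rw [integral_undef hintg, mul_zero]; positivity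
  set H : ℝ → ℝ := fun σ => (g (σ + t * I) + Complex.log (σ + t * I + 1) - Complex.log (σ + t * I - 1)).im with hH
  have hHd : ∀ σ : ℝ, 1 / 2 < σ → HasDerivAt H (φ σ) σ := by
    intro σ hσ
    have a := hasDerivAt_logZeta hg (s := σ + t * I) (by simpa using hσ) (by simp; linarith)
    have b : HasDerivAt (fun x : ℝ => (x:ℂ) + t * I) 1 σ := by
      simpa using ((hasDerivAt_id σ).ofReal_comp).add_const ((t:ℂ) * I)
    have c := a.comp σ b
    exact (Complex.imCLM.hasFDerivAt.comp_hasDerivAt σ c).congr_deriv (by simp [hφ])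
  have hHlim : Tendsto H atTop (nhds 0) := by
    have h1 := (Complex.continuous_im.tendsto 0).comp (LSeries_av_tendsto t)
    rw [Complex.zero_im] at h1
    refine h1.congr' ?_
    filter_upwards [eventually_gt_atTop (1:ℝ)] with σ hσ
    simp only [Function.comp, hH]
    rw [hg.eqD _ (by simpa using hσ)]
    congr 1; ring
  have hH2 : ∀ σ : ℝ, 1 / 2 < σ → σ ≤ 3 / 4 → (1 / π) * H σ ≤ Real.log t / (4 * π * Δ) + (C + 2) * Real.exp (π * Δ) := by
    intro σ hσ hσ'
    have h1 := hC g hg Δ σ t hΔ hσ hσ' ht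
    have h2 := (abs_le.mp (Complex.abs_arg_le_pi (σ + t * I + 1))).2
    have h3 := (abs_le.mp (Complex.abs_arg_le_pi (σ + t * I - 1))).1
    have h4 : (1 / π) * H σ = (1 / π) * (g (σ + t * I)).im + (1 / π) * (Complex.arg (σ + t * I + 1) - Complex.arg (σ + t * I - 1)) := by
      simp only [hH, sub_im, add_im, Complex.log_im]; ring
    have h5 : (1 / π) * (Complex.arg (σ + t * I + 1) - Complex.arg (σ + t * I - 1)) ≤ (1 / π) * (2 * π) :=
      mul_le_mul_of_nonneg_left (by linarith) (by positivity)
    have h6 : (1 / π) * (2 * π) = 2 := by field_simp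
    rw [h4]; linarith
  set s : ℕ → Set ℝ := fun n => Set.Ioi (1 / 2 + 1 / ((n:ℝ) + 4)) with hs
  have hU : ⋃ n, s n = Set.Ioi (1 / 2 : ℝ) := by
    ext x
    simp only [hs, Set.mem_iUnion, Set.mem_Ioi]
    constructor
    · rintro ⟨n, hn⟩
      have : 0 < 1 / ((n:ℝ) + 4) := by positivity
      linarith
    · intro hx
      obtain ⟨n, hn⟩ := exists_nat_one_div_lt (sub_pos.mpr hx)
      refine ⟨n, ?_⟩
      have : 1 / ((n:ℝ) + 4) ≤ 1 / ((n:ℝ) + 1) := by gcongr; norm_num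
      linarith
  have hmono : Monotone s := by
    intro m n hmn
    apply Set.Ioi_subset_Ioi
    have : (m:ℝ) ≤ n := by exact_mod_cast hmn
    gcongr
  have hlim := tendsto_setIntegral_of_monotone (μ := volume) (f := φ) (s := s) (fun i => measurableSet_Ioi) hmono (by rw [hU]; exact hintg)
  rw [hU] at hlim
  refine le_of_tendsto (hlim.const_mul (-(1 / π))) (Eventually.of_forall fun n => ?_)
  have hp : 0 < 1 / ((n:ℝ) + 4) := by positivity
  have hp' : 1 / ((n:ℝ) + 4) ≤ 1 / 4 := by
    apply one_div_le_one_div_of_le (by norm_num); have : (0:ℝ) ≤ n := Nat.cast_nonneg n; linarith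
  have hval : ∫ x in s n, φ x = 0 - H (1 / 2 + 1 / ((n:ℝ) + 4)) := by
    apply integral_Ioi_of_hasDerivAt_of_tendsto'
    · intro x hx
      have hx : 1 / 2 + 1 / ((n:ℝ) + 4) ≤ x := hx
      exact hHd x (by linarith)
    · exact hintg.mono_set (Set.Ioi_subset_Ioi (by linarith))
    · exact hHlim
  rw [hval]
  have := hH2 (1 / 2 + 1 / ((n:ℝ) + 4)) (by linarith) (by linarith)
  linarith

lemma eventually_not_ordinate (t : ℝ) : ∀ᶠ u in nhdsWithin t {t}ᶜ,
    ∀ ρ : ℂ, riemannZeta ρ = 0 → 0 ≤ ρ.re → ρ.re ≤ 1 → ρ.im ≠ u := by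
  have hcomp : IsCompact (Set.Icc (0:ℝ) 1 ×ℂ Set.Icc (t - 1) (t + 1)) := isCompact_Icc.reProdIm isCompact_Icc
  have hfin := hcomp.inter_riemannZetaZeros_finite.image Complex.im
  have h1 : ∀ᶠ u in nhdsWithin t {t}ᶜ, u ∉ Complex.im '' ((Set.Icc (0:ℝ) 1 ×ℂ Set.Icc (t - 1) (t + 1)) ∩ riemannZetaZeros) := by
    have hc := (hfin.subset (Set.sdiff_subset (t := {t}))).isClosed
    have hm : (Complex.im '' ((Set.Icc (0:ℝ) 1 ×ℂ Set.Icc (t - 1) (t + 1)) ∩ riemannZetaZeros) \ {t})ᶜ ∈ nhds t :=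
      hc.isOpen_compl.mem_nhds (by simp)
    filter_upwards [nhdsWithin_le_nhds hm, self_mem_nhdsWithin] with u hu hut hmem
    exact hu ⟨hmem, hut⟩
  have h2 : Set.Icc (t - 1) (t + 1) ∈ nhdsWithin t {t}ᶜ := nhdsWithin_le_nhds (Icc_mem_nhds (by linarith) (by linarith))
  filter_upwards [h1, h2] with u hu hu2 ρ hρ h0 h1' him
  apply hu
  refine ⟨ρ, ⟨?_, hρ⟩, him⟩
  rw [Complex.mem_reProdIm]
  exact ⟨⟨h0, h1'⟩, by rw [him]; exact hu2⟩

theorem final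
    (RH : ∀ ρ : ℂ, riemannZeta ρ = 0 → 0 ≤ ρ.re → ρ.re ≤ 1 → ρ.re = 1 / 2)
    (S : ℝ → ℝ)
    (hS₁ : ∀ t : ℝ, 0 < t →
      (∀ ρ : ℂ, riemannZeta ρ = 0 → 0 ≤ ρ.re → ρ.re ≤ 1 → ρ.im ≠ t) →
      S t = -(1 / π) * ∫ σ in Set.Ioi (1 / 2 : ℝ),
        (deriv riemannZeta (σ + t * Complex.I) / riemannZeta (σ + t * Complex.I)).im)
    (hS₂ : ∀ t : ℝ, 0 < t →
      (∃ ρ : ℂ, riemannZeta ρ = 0 ∧ 0 ≤ ρ.re ∧ ρ.re ≤ 1 ∧ ρ.im = t) →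
      Tendsto (fun ε : ℝ => (S (t + ε) + S (t - ε)) / 2)
        (nhdsWithin 0 {(0 : ℝ)}ᶜ) (nhds (S t))) :
    ∃ C : ℝ, ∀ Δ t : ℝ, 1 ≤ Δ → 10 ≤ t →
      S t ≤ Real.log t / (4 * π * Δ) + C * Real.exp (π * Δ) := by
  obtain ⟨g, hg1, hg2, hg3⟩ := exists_g RH
  have hg : IsG g := ⟨hg1, hg2, hg3⟩
  obtain ⟨C, hC0, hC⟩ := S_integral_bound
  refine ⟨C, ?_⟩
  intro Δ t hΔ ht
  have key : ∀ u : ℝ, 9 ≤ u → (∀ ρ : ℂ, riemannZeta ρ = 0 → 0 ≤ ρ.re → ρ.re ≤ 1 → ρ.im ≠ u) →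
      S u ≤ Real.log u / (4 * π * Δ) + C * Real.exp (π * Δ) := by
    intro u hu hn
    rw [hS₁ u (by linarith) hn]
    exact hC g hg Δ u hΔ hu
  by_cases hord : ∃ ρ : ℂ, riemannZeta ρ = 0 ∧ 0 ≤ ρ.re ∧ ρ.re ≤ 1 ∧ ρ.im = t
  swap
  · refine key t (by linarith) ?_
    intro ρ h1 h2 h3 h4
    exact hord ⟨ρ, h1, h2, h3, h4⟩
  have hlim := hS₂ t (by linarith) hord
  have hp : Tendsto (fun ε : ℝ => t + ε) (nhdsWithin 0 {(0 : ℝ)}ᶜ) (nhdsWithin t {t}ᶜ) := by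
    refine tendsto_nhdsWithin_iff.mpr ⟨?_, ?_⟩
    · exact (Continuous.tendsto' (by fun_prop) _ _ (by simp)).mono_left nhdsWithin_le_nhds
    · filter_upwards [self_mem_nhdsWithin] with ε hε
      simpa using hε
  have hm : Tendsto (fun ε : ℝ => t - ε) (nhdsWithin 0 {(0 : ℝ)}ᶜ) (nhdsWithin t {t}ᶜ) := by
    refine tendsto_nhdsWithin_iff.mpr ⟨?_, ?_⟩
    · exact (Continuous.tendsto' (by fun_prop) _ _ (by simp)).mono_left nhdsWithin_le_nhds
    · filter_upwards [self_mem_nhdsWithin] with ε hε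
      simpa using hε
  have hcl : Tendsto (fun u : ℝ => Real.log u / (4 * π * Δ) + C * Real.exp (π * Δ)) (nhdsWithin t {t}ᶜ)
      (nhds (Real.log t / (4 * π * Δ) + C * Real.exp (π * Δ))) :=
    (((Real.continuousAt_log (by linarith)).tendsto.mono_left nhdsWithin_le_nhds).div_const _).add_const _
  have hR := ((hcl.comp hp).add (hcl.comp hm)).div_const 2
  rw [add_self_div_two] at hR
  have h9 : Set.Ici (9:ℝ) ∈ nhdsWithin t {t}ᶜ := nhdsWithin_le_nhds (Ici_mem_nhds (by linarith))
  refine le_of_tendsto_of_tendsto hlim hR ?_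
  filter_upwards [hp.eventually (eventually_not_ordinate t), hm.eventually (eventually_not_ordinate t),
    hp h9, hm h9] with ε h1 h2 h3 h4
  have a := key (t + ε) h3 h1
  have b := key (t - ε) h4 h2
  simp only [Function.comp]
  linarith
end SBound


/-- Assume the Riemann hypothesis. There is an absolute constant `C` such
that for all `Δ ≥ 1` and all `t ≥ 10`, the stated one-sided bound for `S(t)` holds.
Here `S` is characterized by `S(t) = -(1/π)∫_{1/2}^∞ Im (ζ'/ζ)(σ + it) dσ` when `t` is
not the ordinate of a nontrivial zero, and by the symmetrized limit otherwise. -/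
theorem S_upper_bound_Delta
    (RH : ∀ ρ : ℂ, riemannZeta ρ = 0 → 0 ≤ ρ.re → ρ.re ≤ 1 → ρ.re = 1 / 2)
    (S : ℝ → ℝ)
    (hS₁ : ∀ t : ℝ, 0 < t →
      (∀ ρ : ℂ, riemannZeta ρ = 0 → 0 ≤ ρ.re → ρ.re ≤ 1 → ρ.im ≠ t) →
      S t = -(1 / π) * ∫ σ in Set.Ioi (1 / 2 : ℝ),
        (deriv riemannZeta (σ + t * Complex.I) / riemannZeta (σ + t * Complex.I)).im)
    (hS₂ : ∀ t : ℝ, 0 < t →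
      (∃ ρ : ℂ, riemannZeta ρ = 0 ∧ 0 ≤ ρ.re ∧ ρ.re ≤ 1 ∧ ρ.im = t) →
      Tendsto (fun ε : ℝ => (S (t + ε) + S (t - ε)) / 2)
        (nhdsWithin 0 {(0 : ℝ)}ᶜ) (nhds (S t))) :
    ∃ C : ℝ, ∀ Δ t : ℝ, 1 ≤ Δ → 10 ≤ t →
      S t ≤ Real.log t / (4 * π * Δ) + C * Real.exp (π * Δ) := by
  exact SBound.final RH S hS₁ hS₂
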